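/- Let K be a number field that is either ℚ or an imaginary quadratic field (i.e., [K:ℚ] = 1, or [K:ℚ] = 2 and there is no ring homomorphism from K to ℝ), and let O_K be its ring of integers. Let F = (P,Q) with P, Q ∈ O_K[x,y] satisfy ∂P/∂x·∂Q/∂y − ∂P/∂y·∂Q/∂x = 1, and suppose F is not invertible over K. Then there exists a constant C (depending on F and K) such that for every k ∈ O_K, the number of pairs (a,b) ∈ O_K × O_K with P(a,b) = k is at most C. -/

import Mathlib

open MvPolynomial NumberField

/-- The derivation `f ↦ {P, f}` of `R[x, y]`, where `{·, ·}` is the Jacobian determinant. -/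
noncomputable def bracketWith {R : Type*} [CommRing R] (P : MvPolynomial (Fin 2) R) :
    Derivation R (MvPolynomial (Fin 2) R) (MvPolynomial (Fin 2) R) :=
  pderiv 0 P • pderiv 1 - pderiv 1 P • pderiv 0

lemma bracketWith_apply {R : Type*} [CommRing R] (P f : MvPolynomial (Fin 2) R) :
    bracketWith P f = pderiv 0 P * pderiv 1 f - pderiv 1 P * pderiv 0 f := by
  simp [bracketWith]

lemma bracketWith_self {R : Type*} [CommRing R] (P : MvPolynomial (Fin 2) R) :
    bracketWith P P = 0 := by
  rw [bracketWith_apply]; ring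

lemma Derivation.aeval_fin_two {R B : Type*} [CommRing R] [CommRing B] [Algebra R B]
    (d : Derivation R B B) (g : Fin 2 → B) (f : MvPolynomial (Fin 2) R) :
    d (aeval g f) = aeval g (pderiv 0 f) * d (g 0) + aeval g (pderiv 1 f) * d (g 1) := by
  induction f using MvPolynomial.induction_on with
  | C a => simp [MvPolynomial.algHom_C]
  | add p q hp hq => simp only [map_add, hp, hq]; ring
  | mul_X p i hp =>
    simp only [map_mul, Derivation.leibniz, smul_eq_mul, hp, aeval_X, map_add]
    fin_cases i <;> simp [pderiv_X] <;> ring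

lemma MvPolynomial.eq_zero_of_pderiv_mem {K : Type*} [Field K] [CharZero K]
    {S : Set (MvPolynomial (Fin 2) K)} (hS : ∀ f ∈ S, ∀ i, pderiv i f ∈ S)
    (hC : ∀ c, C c ∈ S → c = 0) {f : MvPolynomial (Fin 2) K} (hf : f ∈ S) : f = 0 := by
  obtain ⟨n, hn⟩ : ∃ n, f.totalDegree ≤ n := ⟨_, le_rfl⟩
  induction n generalizing f with
  | zero =>
    rw [Nat.le_zero, totalDegree_eq_zero_iff_eq_C] at hn
    rw [hn] at hf ⊢
    rw [hC _ hf, map_zero]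
  | succ n ih =>
    have hd : ∀ i, pderiv i f = 0 := by
      intro i
      refine ih (hS f hf i) ?_
      refine Finset.sup_le fun m hm => ?_
      rw [mem_support_iff, coeff_pderiv] at hm
      have := le_totalDegree (mem_support_iff.2 (left_ne_zero_of_mul hm))
      rw [Finsupp.sum_add_index' (by simp) (by simp), Finsupp.sum_single_index rfl] at this
      omega
    have hfC : f = C (coeff 0 f) := by
      ext m
      rw [coeff_C]
      split_ifs with h
      · rw [h]
      · obtain ⟨i, hi⟩ : ∃ i, m i ≠ 0 := by
          by_contra! hm
          exact h (Finsupp.ext fun i => (hm i).symm)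
        have h1 := coeff_pderiv (i := i) f (m - Finsupp.single i 1)
        rw [hd i, coeff_zero, tsub_add_cancel_of_le
          (Finsupp.single_le_iff.2 (Nat.one_le_iff_ne_zero.2 hi))] at h1
        rcases mul_eq_zero.1 h1.symm with h2 | h2
        · exact h2
        · exact absurd h2 (Nat.cast_add_one_ne_zero _)
    rw [hfC] at hf ⊢
    rw [hC _ hf, map_zero]

lemma PowerSeries.coeff_eq_of_derivative_eq (K : Type*) {A : Type*} [Field K] [CharZero K]
    [CommRing A] [Algebra K A] {f g : PowerSeries A} (n : ℕ)
    (h0 : PowerSeries.coeff 0 f = PowerSeries.coeff 0 g)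
    (h : ∀ m < n, PowerSeries.coeff m (PowerSeries.derivative A f) =
      PowerSeries.coeff m (PowerSeries.derivative A g)) :
    PowerSeries.coeff n f = PowerSeries.coeff n g := by
  cases n with
  | zero => exact h0
  | succ n =>
    have := h n (Nat.lt_succ_self n)
    rw [PowerSeries.coeff_derivative, PowerSeries.coeff_derivative] at this
    have hu : IsUnit ((n : A) + 1) := by
      have := (IsUnit.mk0 ((n : K) + 1) (Nat.cast_add_one_ne_zero n)).map (algebraMap K A)
      simpa using this
    exact hu.mul_left_injective this

/-- The Taylor series `∑ (Dⁿ f / n!) sⁿ` of `f` along the derivation `D`. -/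
noncomputable def taylorSeriesFun {K A : Type*} [Field K] [CommRing A] [Algebra K A]
    (D : Derivation K A A) (f : A) : PowerSeries A :=
  PowerSeries.mk fun n => ((n.factorial : K)⁻¹) • (D^[n] f)

section Taylor

variable {K A : Type*} [Field K] [CommRing A] [Algebra K A] (D : Derivation K A A)

lemma coeff_taylorSeriesFun (f : A) (n : ℕ) :
    PowerSeries.coeff n (taylorSeriesFun D f) = ((n.factorial : K)⁻¹) • (D^[n] f) := by
  simp [taylorSeriesFun]

lemma Derivation.iterate_add (n : ℕ) (f g : A) : D^[n] (f + g) = D^[n] f + D^[n] g := by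
  induction n generalizing f g with
  | zero => rfl
  | succ n ih => simp only [Function.iterate_succ_apply, map_add, ih]

lemma Derivation.iterate_apply_zero (n : ℕ) : D^[n] 0 = 0 := by
  induction n with
  | zero => rfl
  | succ n ih => rw [Function.iterate_succ_apply, map_zero, ih]

lemma Derivation.iterate_eq_zero_of_apply_eq_zero {f : A} (hf : D f = 0) {n : ℕ} (hn : n ≠ 0) :
    D^[n] f = 0 := by
  obtain ⟨m, rfl⟩ := Nat.exists_eq_succ_of_ne_zero hn
  rw [Function.iterate_succ_apply, hf, D.iterate_apply_zero]

lemma taylorSeriesFun_add (f g : A) :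
    taylorSeriesFun D (f + g) = taylorSeriesFun D f + taylorSeriesFun D g := by
  ext n
  simp only [coeff_taylorSeriesFun, map_add, D.iterate_add, smul_add]

lemma taylorSeriesFun_of_apply_eq_zero {f : A} (hf : D f = 0) :
    taylorSeriesFun D f = PowerSeries.C f := by
  ext n
  rw [coeff_taylorSeriesFun, PowerSeries.coeff_C]
  split_ifs with hn
  · simp [hn]
  · rw [D.iterate_eq_zero_of_apply_eq_zero hf hn, smul_zero]

variable [CharZero K]

lemma derivative_taylorSeriesFun (f : A) :
    PowerSeries.derivative A (taylorSeriesFun D f) = taylorSeriesFun D (D f) := by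
  ext n
  rw [PowerSeries.coeff_derivative, coeff_taylorSeriesFun, coeff_taylorSeriesFun,
    Function.iterate_succ_apply, smul_mul_assoc]
  have h : (D^[n] (D f)) * ((n : A) + 1) = ((n : K) + 1) • (D^[n] (D f)) := by
    rw [Algebra.smul_def, mul_comm]; simp
  have hn := Nat.cast_add_one_ne_zero (R := K) n
  have hf : (n.factorial : K) ≠ 0 := Nat.cast_ne_zero.2 n.factorial_ne_zero
  rw [h, smul_smul, Nat.factorial_succ]
  congr 1
  push_cast
  field_simp

lemma taylorSeriesFun_mul (f g : A) :
    taylorSeriesFun D (f * g) = taylorSeriesFun D f * taylorSeriesFun D g := by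
  ext n
  induction n using Nat.strong_induction_on generalizing f g with
  | _ n ih =>
    refine PowerSeries.coeff_eq_of_derivative_eq K n ?_ fun m hm => ?_
    · simp [PowerSeries.coeff_mul, coeff_taylorSeriesFun, -PowerSeries.coeff_zero_eq_constantCoeff]
    · rw [derivative_taylorSeriesFun, Derivation.leibniz, Derivation.leibniz,
        derivative_taylorSeriesFun, derivative_taylorSeriesFun, taylorSeriesFun_add]
      simp only [smul_eq_mul, map_add, ih m hm]

/-- The Taylor expansion along a derivation, as a ring homomorphism. -/
noncomputable def taylorSeries : A →+* PowerSeries A where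
  toFun := taylorSeriesFun D
  map_one' := by rw [taylorSeriesFun_of_apply_eq_zero D D.map_one_eq_zero, map_one]
  map_zero' := by rw [taylorSeriesFun_of_apply_eq_zero D (map_zero D), map_zero]
  map_mul' := taylorSeriesFun_mul D
  map_add' := taylorSeriesFun_add D

lemma coeff_taylorSeries (f : A) (n : ℕ) :
    PowerSeries.coeff n (taylorSeries D f) = ((n.factorial : K)⁻¹) • (D^[n] f) :=
  coeff_taylorSeriesFun D f n

lemma taylorSeries_of_apply_eq_zero {f : A} (hf : D f = 0) :
    taylorSeries D f = PowerSeries.C f := taylorSeriesFun_of_apply_eq_zero D hf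

lemma taylorSeries_of_apply_eq_one {f : A} (hf : D f = 1) :
    taylorSeries D f = PowerSeries.C f + PowerSeries.X := by
  ext n
  rw [coeff_taylorSeries, map_add, PowerSeries.coeff_C, PowerSeries.coeff_X]
  rcases n with _ | _ | n
  · simp
  · simp [hf]
  · rw [Function.iterate_succ_apply, hf,
      D.iterate_eq_zero_of_apply_eq_zero D.map_one_eq_zero (Nat.succ_ne_zero n)]
    simp

end Taylor

lemma coeff_mul_sub_mem {A : Type*} [CommRing A] (S : Subring A)
    {f g : PowerSeries A} {n : ℕ} (hn : n ≠ 0)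
    (hf : ∀ m < n, PowerSeries.coeff m f ∈ S) (hg : ∀ m < n, PowerSeries.coeff m g ∈ S) :
    PowerSeries.coeff n (f * g) - (PowerSeries.coeff 0 f * PowerSeries.coeff n g +
      PowerSeries.coeff n f * PowerSeries.coeff 0 g) ∈ S := by
  have h1 : ((0, n) : ℕ × ℕ) ∈ Finset.HasAntidiagonal.antidiagonal n := by simp
  have h2 : ((n, 0) : ℕ × ℕ) ∈ (Finset.HasAntidiagonal.antidiagonal n).erase (0, n) := by simp [hn]
  rw [PowerSeries.coeff_mul, ← Finset.add_sum_erase _ _ h1, ← Finset.add_sum_erase _ _ h2,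
    ← add_assoc, add_sub_cancel_left]
  refine S.sum_mem fun p hp => ?_
  simp only [Finset.mem_erase, Finset.HasAntidiagonal.mem_antidiagonal, ne_eq,
    Prod.ext_iff] at hp
  exact S.mul_mem (hf _ (by omega)) (hg _ (by omega))

/-- For a Jacobian pair over `R`, the divided powers of the associated derivation preserve
polynomials with coefficients in `R`. -/
lemma coeff_taylorSeries_mem_range {R K : Type*} [CommRing R] [Field K] [CharZero K]
    (ι : R →+* K) (P Q : MvPolynomial (Fin 2) R)
    (hJ : pderiv 0 P * pderiv 1 Q - pderiv 1 P * pderiv 0 Q = 1) (n : ℕ)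
    (f : MvPolynomial (Fin 2) R) :
    PowerSeries.coeff n (taylorSeries (bracketWith (map ι P)) (map ι f)) ∈ (map ι).range := by
  have hJK := congrArg (map ι) hJ
  simp only [map_sub, map_mul, map_one, ← pderiv_map] at hJK
  set D := bracketWith (map ι P) with hD
  set S : Subring (MvPolynomial (Fin 2) K) := (map ι).range with hS
  have hmem : ∀ g, map ι g ∈ S := fun g => ⟨g, rfl⟩
  induction n using Nat.strong_induction_on generalizing f with
  | _ n ih =>
    rcases eq_or_ne n 0 with rfl | hn
    · simpa [coeff_taylorSeries] using hmem f
    set T := taylorSeries D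
    set a := PowerSeries.coeff n (T (X 0))
    set b := PowerSeries.coeff n (T (X 1))
    have h0 : ∀ g, PowerSeries.coeff 0 (T g) = g := fun g => by simp [T, coeff_taylorSeries]
    have key : ∀ g : MvPolynomial (Fin 2) R, PowerSeries.coeff n (T (map ι g)) -
        (pderiv 0 (map ι g) * a + pderiv 1 (map ι g) * b) ∈ S := by
      intro g
      induction g using MvPolynomial.induction_on with
      | C r =>
        have : T (C (ι r)) = PowerSeries.C (C (ι r)) :=
          taylorSeries_of_apply_eq_zero D (D.map_algebraMap (ι r))
        simp [this, PowerSeries.coeff_C, hn, S.zero_mem]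
      | add p q hp hq =>
        convert S.add_mem hp hq using 1
        simp only [map_add]; ring
      | mul_X p i hp =>
        have h1 := coeff_mul_sub_mem S hn (f := T (map ι p)) (g := T (map ι (X i)))
          (fun m hm => ih m hm p) (fun m hm => ih m hm (X i))
        have h2 := S.mul_mem hp (hmem (X i))
        convert S.add_mem h1 h2 using 1
        simp only [map_mul, h0, map_X, pderiv_mul]
        fin_cases i <;> simp [pderiv_X, a, b] <;> ring
    have hP : PowerSeries.coeff n (T (map ι P)) = 0 := by
      rw [show T (map ι P) = _ from taylorSeries_of_apply_eq_zero D (bracketWith_self _),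
        PowerSeries.coeff_C, if_neg hn]
    have hQ : PowerSeries.coeff n (T (map ι Q)) ∈ S := by
      rw [show T (map ι Q) = _ from taylorSeries_of_apply_eq_one D
        (by rw [hD, bracketWith_apply, hJK]), map_add, PowerSeries.coeff_C, if_neg hn,
        PowerSeries.coeff_X]
      split_ifs <;> simp [S.zero_mem, S.one_mem]
    have h1 : pderiv 0 (map ι P) * a + pderiv 1 (map ι P) * b ∈ S := by
      have := S.neg_mem (key P)
      rw [hP] at this
      simpa using this
    have h2 : pderiv 0 (map ι Q) * a + pderiv 1 (map ι Q) * b ∈ S := by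
      simpa using S.sub_mem hQ (key Q)
    have hd : ∀ g i, pderiv i (map ι g) ∈ S := fun g i => by
      rw [pderiv_map]; exact hmem _
    have ha : a ∈ S := by
      convert S.sub_mem (S.mul_mem (hd Q 1) h1) (S.mul_mem (hd P 1) h2) using 1
      linear_combination (-a) * hJK
    have hb : b ∈ S := by
      convert S.sub_mem (S.mul_mem (hd P 0) h2) (S.mul_mem (hd Q 0) h1) using 1
      linear_combination (-b) * hJK
    have := S.add_mem (key f) (S.add_mem (S.mul_mem (hd f 0) ha) (S.mul_mem (hd f 1) hb))
    simpa using this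

section Weights

/-- The weight of a monomial in two variables of weights `1` and `-μ`. -/
def slopeWeight (μ : ℚ) (d : Fin 2 →₀ ℕ) : ℚ := d 0 - μ * d 1

lemma slopeWeight_add (μ : ℚ) (d e : Fin 2 →₀ ℕ) :
    slopeWeight μ (d + e) = slopeWeight μ d + slopeWeight μ e := by
  simp only [slopeWeight, Finsupp.add_apply, Nat.cast_add]; ring

/-- Every monomial of `f` is at most `a`, comparing weights first and then the exponents of the
second variable. -/
def IsTopExponent {K : Type*} [CommRing K] (μ : ℚ) (f : MvPolynomial (Fin 2) K)
    (a : Fin 2 →₀ ℕ) : Prop :=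
  ∀ e, coeff e f ≠ 0 → slopeWeight μ e < slopeWeight μ a ∨
    slopeWeight μ e = slopeWeight μ a ∧ e 1 ≤ a 1

variable {K : Type*} [Field K] {μ : ℚ} {f g : MvPolynomial (Fin 2) K} {a b : Fin 2 →₀ ℕ}

lemma exists_isTopExponent (μ : ℚ) (hf : f ≠ 0) : ∃ a, coeff a f ≠ 0 ∧ IsTopExponent μ f a := by
  obtain ⟨a, ha, hmax⟩ := Finset.exists_max_image f.support
    (fun e => toLex (slopeWeight μ e, e 1)) (support_nonempty.2 hf)
  refine ⟨a, mem_support_iff.1 ha, fun e he => ?_⟩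
  have := hmax e (mem_support_iff.2 he)
  rwa [Prod.Lex.toLex_le_toLex] at this

lemma eq_of_slopeWeight_eq {d e : Fin 2 →₀ ℕ} (h : slopeWeight μ d = slopeWeight μ e)
    (h1 : d 1 = e 1) : d = e := by
  ext i
  fin_cases i
  · simp only [slopeWeight, h1, sub_left_inj, Nat.cast_inj] at h
    exact h
  · exact h1

lemma IsTopExponent.coeff_mul (hf : IsTopExponent μ f a) (hg : IsTopExponent μ g b) :
    coeff (a + b) (f * g) = coeff a f * coeff b g := by
  rw [MvPolynomial.coeff_mul]
  refine Finset.sum_eq_single (a, b) ?_ (by simp)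
  rintro ⟨e, h⟩ heh hne
  rw [Finset.HasAntidiagonal.mem_antidiagonal] at heh
  dsimp only at heh ⊢
  by_contra hc
  have he := hf e (left_ne_zero_of_mul hc)
  have hh := hg h (right_ne_zero_of_mul hc)
  have hw := congrArg (slopeWeight μ) heh
  have h1 := DFunLike.congr_fun heh 1
  rw [slopeWeight_add, slopeWeight_add] at hw
  simp only [Finsupp.add_apply] at h1
  have hew : slopeWeight μ e = slopeWeight μ a := by
    rcases he with he | he <;> rcases hh with hh | hh <;> linarith [he, hh]
  have hhw : slopeWeight μ h = slopeWeight μ b := by linarith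
  have he1 : e 1 ≤ a 1 := by rcases he with he | he <;> [linarith; exact he.2]
  have hh1 : h 1 ≤ b 1 := by rcases hh with hh | hh <;> [linarith; exact hh.2]
  have he2 : e 1 = a 1 := by omega
  have hh2 : h 1 = b 1 := by omega
  exact hne (Prod.ext (eq_of_slopeWeight_eq hew he2) (eq_of_slopeWeight_eq hhw hh2))

lemma coeff_X_mul_pderiv (f : MvPolynomial (Fin 2) K) (i : Fin 2) (e : Fin 2 →₀ ℕ) :
    coeff e (X i * pderiv i f) = e i * coeff e f := by
  rw [coeff_X_mul']
  split_ifs with h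
  · have hi : 1 ≤ e i := Nat.one_le_iff_ne_zero.2 (Finsupp.mem_support_iff.1 h)
    rw [coeff_pderiv, tsub_add_cancel_of_le (Finsupp.single_le_iff.2 hi), mul_comm]
    simp [Nat.cast_sub hi]
  · rw [Finsupp.notMem_support_iff.1 h]; simp

lemma IsTopExponent.X_mul_pderiv (hf : IsTopExponent μ f a) (i : Fin 2) :
    IsTopExponent μ (X i * pderiv i f) a := fun e he =>
  hf e (right_ne_zero_of_mul (coeff_X_mul_pderiv f i e ▸ he))

lemma X_mul_X_mul_bracketWith (f g : MvPolynomial (Fin 2) K) :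
    X 0 * X 1 * bracketWith f g = (X 0 * pderiv 0 f) * (X 1 * pderiv 1 g) -
      (X 1 * pderiv 1 f) * (X 0 * pderiv 0 g) := by
  rw [bracketWith_apply]; ring

lemma IsTopExponent.coeff_bracketWith (hf : IsTopExponent μ f a) (hg : IsTopExponent μ g b) :
    coeff (a + b) (X 0 * X 1 * bracketWith f g) =
      ((a 0 : K) * b 1 - a 1 * b 0) * (coeff a f * coeff b g) := by
  rw [X_mul_X_mul_bracketWith, coeff_sub,
    (hf.X_mul_pderiv 0).coeff_mul (hg.X_mul_pderiv 1),
    (hf.X_mul_pderiv 1).coeff_mul (hg.X_mul_pderiv 0)]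
  simp only [coeff_X_mul_pderiv]
  ring

lemma slopeWeight_le_of_coeff_mul_ne_zero {F G : ℚ}
    (hf : ∀ e, coeff e f ≠ 0 → slopeWeight μ e ≤ F)
    (hg : ∀ e, coeff e g ≠ 0 → slopeWeight μ e ≤ G) {e : Fin 2 →₀ ℕ} (he : coeff e (f * g) ≠ 0) :
    slopeWeight μ e ≤ F + G := by
  rw [MvPolynomial.coeff_mul] at he
  obtain ⟨⟨d, h⟩, hd, hne⟩ := Finset.exists_ne_zero_of_sum_ne_zero he
  rw [Finset.HasAntidiagonal.mem_antidiagonal] at hd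
  rw [← hd, slopeWeight_add]
  exact add_le_add (hf _ (left_ne_zero_of_mul hne)) (hg _ (right_ne_zero_of_mul hne))

lemma slopeWeight_le_of_coeff_bracketWith_ne_zero {F G : ℚ}
    (hf : ∀ e, coeff e f ≠ 0 → slopeWeight μ e ≤ F)
    (hg : ∀ e, coeff e g ≠ 0 → slopeWeight μ e ≤ G) {e : Fin 2 →₀ ℕ}
    (he : coeff e (X 0 * X 1 * bracketWith f g) ≠ 0) : slopeWeight μ e ≤ F + G := by
  have hX : ∀ (h : MvPolynomial (Fin 2) K) (H : ℚ),
      (∀ e, coeff e h ≠ 0 → slopeWeight μ e ≤ H) → ∀ i e, coeff e (X i * pderiv i h) ≠ 0 →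
      slopeWeight μ e ≤ H := fun h H hh i e he =>
    hh e (right_ne_zero_of_mul (coeff_X_mul_pderiv h i e ▸ he))
  rw [X_mul_X_mul_bracketWith, coeff_sub] at he
  by_cases h1 : coeff e ((X 0 * pderiv 0 f) * (X 1 * pderiv 1 g)) = 0
  · rw [h1, zero_sub, neg_ne_zero] at he
    exact slopeWeight_le_of_coeff_mul_ne_zero (hX f F hf 1) (hX g G hg 0) he
  · exact slopeWeight_le_of_coeff_mul_ne_zero (hX f F hf 0) (hX g G hg 1) h1

lemma coeff_aeval_X_zero (f : MvPolynomial (Fin 2) K) (i : ℕ) :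
    (aeval ![(Polynomial.X : Polynomial K), 0] f).coeff i = coeff (Finsupp.single 0 i) f := by
  induction f using MvPolynomial.induction_on' with
  | monomial d r =>
    rw [aeval_monomial, coeff_monomial, Finsupp.prod_fintype _ _ (by simp)]
    simp only [Fin.prod_univ_two, Matrix.cons_val_zero, Matrix.cons_val_one]
    rw [Polynomial.algebraMap_eq, Polynomial.coeff_C_mul]
    by_cases h1 : d 1 = 0
    · rw [h1, pow_zero, mul_one, Polynomial.coeff_X_pow]
      have : (d = Finsupp.single 0 i) ↔ i = d 0 := by
        constructor
        · rintro rfl; simp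
        · rintro rfl
          ext j; fin_cases j <;> simp [h1]
      simp [this]
    · have : d ≠ Finsupp.single 0 i := by rintro rfl; simp at h1
      simp [this, h1]
  | add p q hp hq => simp [hp, hq]

lemma coeff_aeval_X_zero_polynomial (w : Polynomial K) (d : Fin 2 →₀ ℕ) :
    coeff d (Polynomial.aeval (X 0 : MvPolynomial (Fin 2) K) w) =
      if d 1 = 0 then w.coeff (d 0) else 0 := by
  induction w using Polynomial.induction_on' with
  | add p q hp hq => simp only [map_add, coeff_add, hp, hq, Polynomial.coeff_add]; split_ifs <;> simp
  | monomial n r =>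
    rw [Polynomial.aeval_monomial, algebraMap_eq, coeff_C_mul, coeff_X_pow,
      Polynomial.coeff_monomial]
    have : (Finsupp.single 0 n = d) ↔ d 1 = 0 ∧ n = d 0 := by
      constructor
      · rintro rfl; simp
      · rintro ⟨h1, rfl⟩
        ext j; fin_cases j <;> simp [h1]
    by_cases h1 : d 1 = 0 <;> simp [this, h1]

end Weights

section PolynomialSection

variable {K : Type*} [Field K] [CharZero K]

/-- If a Jacobian matrix of determinant `w(s)` has first entry `-w(s) z + O(z²)` and second entry
`q + s + O(z)`, then the monomials of the second one lie strictly below the line of slope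
`natDegree w`. -/
lemma lt_natDegree_mul_of_bracketWith_eq {p g : MvPolynomial (Fin 2) K} {w : Polynomial K} {q : K}
    (hw : w ≠ 0) (hb : bracketWith p g = Polynomial.aeval (X 0) w)
    (hp0 : ∀ e, e 1 = 0 → coeff e p = 0)
    (hp1 : ∀ e, e 1 = 1 → coeff e p = -w.coeff (e 0))
    (hg : ∀ e, e 1 = 0 → coeff e g = (Polynomial.C q + Polynomial.X).coeff (e 0))
    (e : Fin 2 →₀ ℕ) (he : coeff e g ≠ 0) (he1 : e 1 ≠ 0) :
    (e 0 : ℚ) - 1 < w.natDegree * e 1 := by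
  set c : ℚ := (w.natDegree : ℚ) with hc
  by_contra! hcon
  set Sp := p.support.filter fun e => 2 ≤ e 1 with hSp
  set Sg := g.support.filter fun e => 1 ≤ e 1 with hSg
  set S : Finset ℚ := Sp.image (fun e => ((e 0 : ℚ) - c) / (e 1 - 1)) ∪
    Sg.image (fun e => ((e 0 : ℚ) - 1) / e 1) with hS
  have hemem : e ∈ Sg := by
    simp only [hSg, Finset.mem_filter, mem_support_iff]
    exact ⟨he, by omega⟩
  have heS : ((e 0 : ℚ) - 1) / e 1 ∈ S :=
    Finset.mem_union_right _ (Finset.mem_image_of_mem _ hemem)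
  set μ := S.max' ⟨_, heS⟩ with hμ
  have hle : ∀ x ∈ S, x ≤ μ := fun x hx => S.le_max' x hx
  have hcμ : c ≤ μ := by
    refine le_trans ?_ (hle _ heS)
    rw [le_div_iff₀ (by positivity)]
    exact hcon
  have hpw : ∀ d, coeff d p ≠ 0 → slopeWeight μ d ≤ c - μ := by
    intro d hd
    rcases lt_or_ge (d 1) 2 with h2 | h2
    · have h1 : d 1 = 1 := by
        rcases (show d 1 = 0 ∨ d 1 = 1 by omega) with h | h
        · exact absurd (hp0 d h) hd
        · exact h
      rw [hp1 d h1, neg_ne_zero] at hd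
      have : (d 0 : ℚ) ≤ c := by rw [hc]; exact_mod_cast Polynomial.le_natDegree_of_ne_zero hd
      rw [slopeWeight, h1]; push_cast; linarith
    · have h2' : (2 : ℚ) ≤ d 1 := by exact_mod_cast h2
      have := hle _ (Finset.mem_union_left _ (Finset.mem_image_of_mem
        (fun e : Fin 2 →₀ ℕ => ((e 0 : ℚ) - c) / (e 1 - 1))
        (show d ∈ Sp by simp [hSp, hd, h2])))
      rw [div_le_iff₀ (by linarith)] at this
      rw [slopeWeight]; linarith
  have hgw : ∀ d, coeff d g ≠ 0 → slopeWeight μ d ≤ 1 := by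
    intro d hd
    rcases Nat.eq_zero_or_pos (d 1) with h1 | h1
    · rw [hg d h1] at hd
      have h01 : d 0 ≤ 1 := by
        by_contra! h
        apply hd
        rw [Polynomial.coeff_add, Polynomial.coeff_C, Polynomial.coeff_X, if_neg (by omega),
          if_neg (by omega), add_zero]
      rw [slopeWeight, h1]
      have : (d 0 : ℚ) ≤ 1 := by exact_mod_cast h01
      simpa using this
    · have h1' : (0 : ℚ) < d 1 := by exact_mod_cast h1
      have := hle _ (Finset.mem_union_right _ (Finset.mem_image_of_mem
        (fun e : Fin 2 →₀ ℕ => ((e 0 : ℚ) - 1) / e 1)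
        (show d ∈ Sg by simp only [hSg, Finset.mem_filter, mem_support_iff]; exact ⟨hd, h1⟩)))
      rw [div_le_iff₀ h1'] at this
      rw [slopeWeight]; linarith
  set dp : Fin 2 →₀ ℕ := Finsupp.single 0 w.natDegree + Finsupp.single 1 1 with hdp
  have hdpne : coeff dp p ≠ 0 := by
    rw [hp1 dp (by simp [hdp]), neg_ne_zero]
    simpa [hdp] using hw
  have hdpw : slopeWeight μ dp = c - μ := by simp [slopeWeight, hdp, hc]
  set dg : Fin 2 →₀ ℕ := Finsupp.single 0 1 with hdg
  have hdgne : coeff dg g ≠ 0 := by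
    rw [hg dg (by simp [hdg])]
    simp [hdg]
  have hdgw : slopeWeight μ dg = 1 := by simp [slopeWeight, hdg]
  obtain ⟨a, ha, hat⟩ := exists_isTopExponent (f := p) μ (by rintro rfl; simp at hdpne)
  obtain ⟨b, hb', hbt⟩ := exists_isTopExponent (f := g) μ (by rintro rfl; simp at hdgne)
  have haw : slopeWeight μ a = c - μ := by
    refine le_antisymm (hpw a ha) ?_
    rcases hat dp hdpne with h | h <;> [linarith; linarith [h.1]]
  have hbw : slopeWeight μ b = 1 := by
    refine le_antisymm (hgw b hb') ?_
    rcases hbt dg hdgne with h | h <;> [linarith; linarith [h.1]]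
  have ha1 : 1 ≤ a 1 := Nat.one_le_iff_ne_zero.2 fun h => ha (hp0 a h)
  have hab : 2 ≤ a 1 + b 1 := by
    have hmem : μ ∈ S := S.max'_mem ⟨_, heS⟩
    rcases Finset.mem_union.1 hmem with h | h
    · obtain ⟨d, hd, hdμ⟩ := Finset.mem_image.1 h
      simp only [hSp, Finset.mem_filter, mem_support_iff] at hd
      have h2' : (2 : ℚ) ≤ d 1 := by exact_mod_cast hd.2
      rw [div_eq_iff (by linarith)] at hdμ
      have hdw : slopeWeight μ d = c - μ := by rw [slopeWeight]; linarith
      rcases hat d hd.1 with h | h <;> [linarith; linarith [h.2, hd.2]]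
    · obtain ⟨d, hd, hdμ⟩ := Finset.mem_image.1 h
      simp only [hSg, Finset.mem_filter, mem_support_iff] at hd
      have h2' : (1 : ℚ) ≤ d 1 := by exact_mod_cast hd.2
      rw [div_eq_iff (by linarith)] at hdμ
      have hdw : slopeWeight μ d = 1 := by rw [slopeWeight]; linarith
      rcases hbt d hd.1 with h | h <;> [linarith; linarith [h.2, hd.2]]
  have hco := hat.coeff_bracketWith hbt
  have hdet : ((a 0 : K) * b 1 - a 1 * b 0) ≠ 0 := by
    have hq : ((a 0 : ℚ) * b 1 - a 1 * b 0) < 0 := by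
      rw [slopeWeight] at haw hbw
      have e1 : (a 0 : ℚ) = c - μ + μ * a 1 := by linarith
      have e2 : (b 0 : ℚ) = 1 + μ * b 1 := by linarith
      have h1 : (1 : ℚ) ≤ a 1 := by exact_mod_cast ha1
      have h2 : (0 : ℚ) ≤ b 1 := by positivity
      rw [e1, e2]
      nlinarith
    have hz : ((a 0 : ℤ) * b 1 - a 1 * b 0) ≠ 0 := by
      intro h
      have : ((a 0 : ℚ) * b 1 - a 1 * b 0) = 0 := by exact_mod_cast h
      linarith
    exact_mod_cast (Int.cast_ne_zero (α := K)).2 hz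
  have hne : coeff (a + b) (X 0 * X 1 * bracketWith p g) ≠ 0 := by
    rw [hco]; exact mul_ne_zero hdet (mul_ne_zero ha hb')
  rw [hb, mul_assoc, coeff_X_mul'] at hne
  split_ifs at hne
  · rw [coeff_X_mul'] at hne
    split_ifs at hne
    · rw [coeff_aeval_X_zero_polynomial] at hne
      refine hne (if_neg ?_)
      simp only [Finsupp.coe_tsub, Finsupp.add_apply, Pi.sub_apply, Finsupp.single_apply]
      simp
      omega
    · exact hne rfl
  · exact hne rfl

end PolynomialSection

section JacobianPair

variable {K : Type*} [Field K] {P Q : MvPolynomial (Fin 2) K}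

lemma pderiv_pderiv_comm (f : MvPolynomial (Fin 2) K) (i j : Fin 2) :
    pderiv i (pderiv j f) = pderiv j (pderiv i f) := by
  have h : ⁅pderiv (R := K) i, pderiv j⁆ = 0 := MvPolynomial.derivation_ext fun k => by
    rw [Derivation.commutator_apply, pderiv_X, pderiv_X]
    simp only [Pi.single_apply]
    split_ifs <;> simp
  have := DFunLike.congr_fun h f
  rwa [Derivation.commutator_apply, Derivation.zero_apply, sub_eq_zero] at this

lemma bracketWith_neg (f g : MvPolynomial (Fin 2) K) :
    bracketWith (-f) g = -bracketWith f g := by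
  simp only [bracketWith_apply, map_neg]; ring

lemma bracketWith_neg_self (hJ : pderiv 0 P * pderiv 1 Q - pderiv 1 P * pderiv 0 Q = 1) :
    bracketWith (-Q) P = 1 := by
  simp only [bracketWith_apply, map_neg]; linear_combination hJ

lemma pderiv_eq_bracketWith (hJ : pderiv 0 P * pderiv 1 Q - pderiv 1 P * pderiv 0 Q = 1)
    (i : Fin 2) (f : MvPolynomial (Fin 2) K) :
    pderiv i f = pderiv i Q * bracketWith P f + pderiv i P * bracketWith (-Q) f := by
  simp only [bracketWith_apply, map_neg]
  fin_cases i <;> simp only [Fin.zero_eta, Fin.mk_one]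
  · linear_combination (-pderiv 0 f) * hJ
  · linear_combination (-pderiv 1 f) * hJ

lemma bracketWith_comm (hJ : pderiv 0 P * pderiv 1 Q - pderiv 1 P * pderiv 0 Q = 1)
    (f : MvPolynomial (Fin 2) K) :
    bracketWith P (bracketWith (-Q) f) = bracketWith (-Q) (bracketWith P f) := by
  have h0 := congrArg (pderiv 0) hJ
  have h1 := congrArg (pderiv 1) hJ
  simp only [map_sub, pderiv_mul, pderiv_one, pderiv_pderiv_comm _ 1 0] at h0 h1
  simp only [bracketWith_apply, map_neg, map_sub, pderiv_mul, pderiv_pderiv_comm _ 1 0]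
  linear_combination (-pderiv 1 f) * h0 + (pderiv 0 f) * h1

lemma bracketWith_neg_iterate_comm (hJ : pderiv 0 P * pderiv 1 Q - pderiv 1 P * pderiv 0 Q = 1)
    (n : ℕ) (f : MvPolynomial (Fin 2) K) :
    bracketWith P ((bracketWith (-Q))^[n] f) = (bracketWith (-Q))^[n] (bracketWith P f) :=
  (Function.Commute.iterate_right (f := bracketWith P) (g := bracketWith (-Q))
    (fun f => bracketWith_comm hJ f) n) f

lemma bracketWith_aeval (g : Fin 2 → MvPolynomial (Fin 2) K) (f h : MvPolynomial (Fin 2) K) :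
    bracketWith (aeval g f) (aeval g h) =
      aeval g (bracketWith f h) * bracketWith (g 0) (g 1) := by
  simp only [bracketWith_apply, Derivation.aeval_fin_two, map_sub, map_mul]
  ring

/-- A pair with Jacobian determinant one has algebraically independent components. -/
lemma aeval_injective_of_jacobian [CharZero K]
    (hJ : pderiv 0 P * pderiv 1 Q - pderiv 1 P * pderiv 0 Q = 1) :
    Function.Injective (aeval (R := K) ![P, Q]) := by
  refine (injective_iff_map_eq_zero _).2 fun f hf => ?_
  refine MvPolynomial.eq_zero_of_pderiv_mem (S := {f | aeval ![P, Q] f = 0}) ?_ ?_ hf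
  · intro f hf i
    have h0 := (bracketWith (-Q)).aeval_fin_two ![P, Q] f
    have h1 := (bracketWith P).aeval_fin_two ![P, Q] f
    have hQ : bracketWith (-Q) Q = 0 := by rw [bracketWith_neg, bracketWith_self, neg_zero]
    have hPQ : bracketWith P Q = 1 := by rw [bracketWith_apply, hJ]
    simp only [Set.mem_ofPred_eq] at hf
    simp only [hf, map_zero, Matrix.cons_val_zero, Matrix.cons_val_one, bracketWith_neg_self hJ,
      hQ, hPQ, bracketWith_self, mul_one, mul_zero, add_zero, zero_add] at h0 h1
    fin_cases i
    · exact h0.symm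
    · exact h1.symm
  · intro c hc
    simpa using hc

end JacobianPair

section PolynomialSection

variable {K : Type*} [Field K] {P Q : MvPolynomial (Fin 2) K} {x y : Polynomial K}
  {k q : K}

/-- Along a polynomial section of `Q` over a fibre of `P`, the derivative is the Hamiltonian
derivation of `P`. -/
lemma derivative_eq_of_section (hJ : pderiv 0 P * pderiv 1 Q - pderiv 1 P * pderiv 0 Q = 1)
    (hP : aeval ![x, y] P = Polynomial.C k)
    (hQ : aeval ![x, y] Q = Polynomial.C q + Polynomial.X) :
    Polynomial.derivative x = -aeval ![x, y] (pderiv 1 P) ∧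
      Polynomial.derivative y = aeval ![x, y] (pderiv 0 P) := by
  have h0 := (Polynomial.derivative' (R := K)).aeval_fin_two ![x, y] P
  have h1 := (Polynomial.derivative' (R := K)).aeval_fin_two ![x, y] Q
  have hj := congrArg (aeval ![x, y]) hJ
  rw [hP] at h0
  rw [hQ] at h1
  simp [Polynomial.derivative'] at h0 h1 hj
  constructor
  · linear_combination (-Polynomial.derivative x) * hj +
      (-aeval ![x, y] (pderiv 1 Q)) * h0 + (aeval ![x, y] (pderiv 1 P)) * h1
  · linear_combination (-Polynomial.derivative y) * hj +
      (aeval ![x, y] (pderiv 0 Q)) * h0 - (aeval ![x, y] (pderiv 0 P)) * h1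

lemma derivative_aeval_of_section
    (hJ : pderiv 0 P * pderiv 1 Q - pderiv 1 P * pderiv 0 Q = 1)
    (hP : aeval ![x, y] P = Polynomial.C k)
    (hQ : aeval ![x, y] Q = Polynomial.C q + Polynomial.X) (f : MvPolynomial (Fin 2) K) :
    Polynomial.derivative (aeval ![x, y] f) = aeval ![x, y] (bracketWith P f) := by
  have h := (Polynomial.derivative' (R := K)).aeval_fin_two ![x, y] f
  obtain ⟨hx, hy⟩ := derivative_eq_of_section hJ hP hQ
  simp [Polynomial.derivative'] at h
  rw [h, hx, hy, bracketWith_apply, map_sub, map_mul, map_mul]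
  ring

end PolynomialSection

section PolynomialSection

variable {K : Type*} [Field K] {P Q : MvPolynomial (Fin 2) K} {x y : Polynomial K} {k q : K}

lemma coeff_eq_coeff_aeval_X_zero (f : MvPolynomial (Fin 2) K) {e : Fin 2 →₀ ℕ} (he : e 1 = 0) :
    coeff e f = (aeval ![(Polynomial.X : Polynomial K), 0] f).coeff (e 0) := by
  rw [coeff_aeval_X_zero]
  congr 1
  ext i; fin_cases i <;> simp [he]

lemma aeval_X_zero_polynomial_aeval (f : Polynomial K) :
    aeval ![(Polynomial.X : Polynomial K), 0]
      (Polynomial.aeval (X 0 : MvPolynomial (Fin 2) K) f) = f := by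
  rw [← Polynomial.aeval_algHom_apply, aeval_X]
  simp

variable [CharZero K]

/-- A polynomial section over a fibre thickens to a dominant map of the plane, whose second
component has all its monomials strictly below a line of integral slope. -/
lemma exists_thickening (hJ : pderiv 0 P * pderiv 1 Q - pderiv 1 P * pderiv 0 Q = 1)
    (hP : aeval ![x, y] P = Polynomial.C k)
    (hQ : aeval ![x, y] Q = Polynomial.C q + Polynomial.X) :
    ∃ (Φ : MvPolynomial (Fin 2) K →ₐ[K] MvPolynomial (Fin 2) K) (w : Polynomial K), w ≠ 0 ∧
      (∀ f, aeval ![Polynomial.X, 0] (Φ f) = aeval ![x, y] f) ∧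
      (∀ f g, bracketWith (Φ f) (Φ g) = Φ (bracketWith f g) * Polynomial.aeval (X 0) w) ∧
      ∀ e, coeff e (Φ Q) ≠ 0 → e 1 ≠ 0 → (e 0 : ℚ) - 1 < w.natDegree * e 1 := by
  obtain ⟨hx, hy⟩ := derivative_eq_of_section hJ hP hQ
  obtain ⟨α, β, hαβ⟩ : ∃ α β : K, Polynomial.C β * Polynomial.derivative x -
      Polynomial.C α * Polynomial.derivative y ≠ 0 := by
    by_contra! h
    have h0 := h 0 1
    have h1 := h (-1) 0
    simp only [map_one, one_mul, map_zero, zero_mul, sub_zero, map_neg, neg_mul, zero_sub,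
      neg_neg] at h0 h1
    have hj := congrArg (aeval ![x, y]) hJ
    rw [hx, neg_eq_zero] at h0
    rw [hy] at h1
    simp [h0, h1] at hj
  set w := Polynomial.C β * Polynomial.derivative x - Polynomial.C α * Polynomial.derivative y
    with hw
  set φ : Fin 2 → MvPolynomial (Fin 2) K :=
    ![Polynomial.aeval (X 0) x + C α * X 1, Polynomial.aeval (X 0) y + C β * X 1] with hφ
  have hev : ∀ f : MvPolynomial (Fin 2) K, aeval ![Polynomial.X, 0] (aeval φ f) = aeval ![x, y] f := by
    intro f
    have : (aeval ![(Polynomial.X : Polynomial K), 0]).comp (aeval φ) = aeval ![x, y] := by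
      refine MvPolynomial.algHom_ext fun i => ?_
      fin_cases i <;> simp [hφ, aeval_X_zero_polynomial_aeval]
    exact DFunLike.congr_fun this f
  have hd : ∀ (f : Polynomial K) (i : Fin 2), pderiv i (Polynomial.aeval
      (X 0 : MvPolynomial (Fin 2) K) f) = if i = 0 then
        Polynomial.aeval (X 0 : MvPolynomial (Fin 2) K) (Polynomial.derivative f) else 0 := by
    intro f i
    rw [Derivation.map_aeval, pderiv_X]
    fin_cases i <;> simp
  have hbr : bracketWith (φ 0) (φ 1) = Polynomial.aeval (X 0) w := by
    simp [bracketWith_apply, hφ, hd, hw, pderiv_X]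
    simp [← algebraMap_eq]
    ring
  have hb : ∀ f g : MvPolynomial (Fin 2) K, bracketWith (aeval φ f) (aeval φ g) =
      aeval φ (bracketWith f g) * Polynomial.aeval (X 0) w := fun f g => by
    rw [bracketWith_aeval, hbr]
  refine ⟨aeval φ, w, hαβ, hev, hb, lt_natDegree_mul_of_bracketWith_eq
    (p := aeval φ P - C k) (q := q) hαβ ?_ ?_ ?_ ?_⟩
  · have hPQ : bracketWith P Q = 1 := by rw [bracketWith_apply, hJ]
    have := hb P Q
    rw [hPQ, map_one, one_mul] at this
    rw [← this]
    simp [bracketWith_apply]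
  · intro e he
    rw [coeff_eq_coeff_aeval_X_zero _ he, map_sub, hev, hP]
    simp
  · intro e he
    obtain ⟨d, hd1, rfl⟩ : ∃ d : Fin 2 →₀ ℕ, d 1 = 0 ∧ e = d + Finsupp.single 1 1 :=
      ⟨Finsupp.single 0 (e 0), by simp, by ext i; fin_cases i <;> simp [he]⟩
    have h1 := coeff_pderiv (i := 1) (aeval φ P - C k) d
    rw [hd1, Nat.cast_zero, zero_add, mul_one] at h1
    rw [← h1, coeff_eq_coeff_aeval_X_zero _ hd1, ← Polynomial.coeff_neg]
    have : (d + Finsupp.single 1 1 : Fin 2 →₀ ℕ) 0 = d 0 := by simp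
    rw [this]
    congr 1
    rw [map_sub, pderiv_C, sub_zero, Derivation.aeval_fin_two, map_add, map_mul, map_mul, hev, hev,
      hw, hx, hy]
    simp [hφ, hd, pderiv_X]
    ring
  · intro e he
    rw [coeff_eq_coeff_aeval_X_zero _ he, hev, hQ]

/-- Along a polynomial section the derivation `f ↦ {f, Q}` is eventually zero. -/
lemma exists_iterate_bracketWith_eq_zero
    (hJ : pderiv 0 P * pderiv 1 Q - pderiv 1 P * pderiv 0 Q = 1)
    (hP : aeval ![x, y] P = Polynomial.C k)
    (hQ : aeval ![x, y] Q = Polynomial.C q + Polynomial.X) (f : MvPolynomial (Fin 2) K) :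
    ∃ N, ∀ n ≥ N, aeval ![x, y] ((bracketWith (-Q))^[n] f) = 0 := by
  obtain ⟨Φ, w, hw, hev, hb, hlt⟩ := exists_thickening hJ hP hQ
  set B : ℕ := (Φ Q).support.sup (fun e => e 1) + 1 with hB
  have hBpos : (0 : ℚ) < B := by rw [hB]; positivity
  set μ : ℚ := w.natDegree - 1 / B with hμ
  have hQw : ∀ e, coeff e (Φ Q) ≠ 0 → slopeWeight μ e ≤ 1 := by
    intro e he
    rcases Nat.eq_zero_or_pos (e 1) with h1 | h1
    · rw [coeff_eq_coeff_aeval_X_zero _ h1, hev, hQ] at he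
      have h01 : e 0 ≤ 1 := by
        by_contra! h
        apply he
        rw [Polynomial.coeff_add, Polynomial.coeff_C, Polynomial.coeff_X, if_neg (by omega),
          if_neg (by omega), add_zero]
      rw [slopeWeight, h1]
      have : (e 0 : ℚ) ≤ 1 := by exact_mod_cast h01
      simpa using this
    · have h2 := hlt e he h1.ne'
      have h3 : (e 0 : ℚ) ≤ w.natDegree * e 1 := by
        have : (e 0 : ℚ) < w.natDegree * e 1 + 1 := by linarith
        have h' : e 0 < w.natDegree * e 1 + 1 := by exact_mod_cast this
        exact_mod_cast Nat.lt_succ_iff.1 h'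
      have h4 : (e 1 : ℚ) ≤ B := by
        have := Finset.le_sup (f := fun e : Fin 2 →₀ ℕ => e 1) (mem_support_iff.2 he)
        rw [hB]; exact_mod_cast this.trans (Nat.le_succ _)
      have h5 : 1 / (B : ℚ) * e 1 ≤ 1 := by
        rw [one_div_mul_eq_div, div_le_one hBpos]; exact h4
      rw [slopeWeight, hμ, sub_mul]
      linarith
  have hstep : ∀ (g : MvPolynomial (Fin 2) K) (W : ℚ),
      (∀ e, coeff e (Φ g) ≠ 0 → slopeWeight μ e ≤ W) →
      ∀ e, coeff e (Φ (bracketWith (-Q) g)) ≠ 0 → slopeWeight μ e ≤ W - 1 / B := by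
    intro g W hg e he
    obtain ⟨t, ht, htop⟩ := exists_isTopExponent (f := Φ (bracketWith (-Q) g)) μ
      (by intro h; simp [h] at he)
    have hte : slopeWeight μ e ≤ slopeWeight μ t := by
      rcases htop e he with h | h <;> [exact h.le; exact h.1.le]
    refine hte.trans ?_
    set dw : Fin 2 →₀ ℕ := Finsupp.single 0 w.natDegree with hdw
    have hwtop : IsTopExponent μ (Polynomial.aeval (X 0 : MvPolynomial (Fin 2) K) w) dw := by
      intro d hd
      rw [coeff_aeval_X_zero_polynomial] at hd
      split_ifs at hd with h1
      · have h2 : (d 0 : ℚ) ≤ w.natDegree := by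
          exact_mod_cast Polynomial.le_natDegree_of_ne_zero hd
        simp only [slopeWeight, h1, hdw]
        simp only [Nat.cast_zero, mul_zero, sub_zero, Finsupp.single_eq_same, ne_eq, one_ne_zero,
          not_false_eq_true, Finsupp.single_eq_of_ne, le_refl, and_true]
        exact h2.lt_or_eq
      · exact absurd rfl hd
    have hdwne : coeff dw (Polynomial.aeval (X 0 : MvPolynomial (Fin 2) K) w) ≠ 0 := by
      rw [coeff_aeval_X_zero_polynomial]
      simpa [hdw] using hw
    have hco : coeff (Finsupp.single 0 1 + (Finsupp.single 1 1 + (t + dw)))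
        (X 0 * X 1 * bracketWith (Φ (-Q)) (Φ g)) ≠ 0 := by
      rw [hb, mul_assoc, coeff_X_mul, coeff_X_mul, htop.coeff_mul hwtop]
      exact mul_ne_zero ht hdwne
    have hle := slopeWeight_le_of_coeff_bracketWith_ne_zero (F := 1) (G := W)
      (fun e he => hQw e (by simpa using he)) hg hco
    simp only [slopeWeight_add] at hle
    have e1 : slopeWeight μ (Finsupp.single 0 1) = 1 := by simp [slopeWeight]
    have e2 : slopeWeight μ (Finsupp.single 1 1) = -μ := by simp [slopeWeight]
    have e3 : slopeWeight μ dw = w.natDegree := by simp [slopeWeight, hdw]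
    rw [e1, e2, e3, hμ] at hle
    linarith
  obtain ⟨W, hW⟩ : ∃ W : ℚ, ∀ e, coeff e (Φ f) ≠ 0 → slopeWeight μ e ≤ W := by
    obtain ⟨W, hW⟩ := ((Φ f).support.image (slopeWeight μ)).bddAbove
    exact ⟨W, fun e he => hW (Finset.mem_coe.2 (Finset.mem_image_of_mem _
      (mem_support_iff.2 he)))⟩
  have hiter : ∀ n : ℕ, ∀ e, coeff e (Φ ((bracketWith (-Q))^[n] f)) ≠ 0 →
      slopeWeight μ e ≤ W - n * (1 / B) := by
    intro n
    induction n with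
    | zero => simpa using hW
    | succ n ih =>
      intro e he
      rw [Function.iterate_succ_apply'] at he
      have := hstep _ _ ih e he
      push_cast; linarith
  obtain ⟨N, hN⟩ := exists_nat_gt (W * B)
  refine ⟨N, fun n hn => ?_⟩
  rw [← hev]
  ext j
  rw [coeff_aeval_X_zero, Polynomial.coeff_zero]
  by_contra hne
  have h1 := hiter n _ hne
  have h2 : (0 : ℚ) ≤ slopeWeight μ (Finsupp.single 0 j) := by simp [slopeWeight]
  have h3 : (N : ℚ) ≤ n := by exact_mod_cast hn
  have h4 : (n : ℚ) * (1 / B) ≤ W := by linarith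
  rw [mul_one_div, div_le_iff₀ hBpos] at h4
  linarith

end PolynomialSection

section Inverse

variable {K : Type*} [Field K] [CharZero K] {P Q : MvPolynomial (Fin 2) K} {x y : Polynomial K}
  {k q : K}

/-- Flow out of a polynomial section, as a ring homomorphism into power series. -/
noncomputable def sectionFlow (Q : MvPolynomial (Fin 2) K) (x y : Polynomial K) :
    MvPolynomial (Fin 2) K →+* PowerSeries (Polynomial K) :=
  (PowerSeries.map (aeval ![x, y] : MvPolynomial (Fin 2) K →ₐ[K] Polynomial K).toRingHom).comp
    (taylorSeries (bracketWith (-Q)))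

lemma coeff_sectionFlow (f : MvPolynomial (Fin 2) K) (n : ℕ) :
    PowerSeries.coeff n (sectionFlow Q x y f) =
      ((n.factorial : K)⁻¹) • aeval ![x, y] ((bracketWith (-Q))^[n] f) := by
  simp [sectionFlow, coeff_taylorSeries]

lemma sectionFlow_fst (hJ : pderiv 0 P * pderiv 1 Q - pderiv 1 P * pderiv 0 Q = 1)
    (hP : aeval ![x, y] P = Polynomial.C k) :
    sectionFlow Q x y P = PowerSeries.C (Polynomial.C k) + PowerSeries.X := by
  rw [sectionFlow, RingHom.comp_apply, taylorSeries_of_apply_eq_one _ (bracketWith_neg_self hJ)]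
  simp [hP]

lemma sectionFlow_snd (hQ : aeval ![x, y] Q = Polynomial.C q + Polynomial.X) :
    sectionFlow Q x y Q = PowerSeries.C (Polynomial.C q + Polynomial.X) := by
  have h : bracketWith (-Q) Q = 0 := by rw [bracketWith_neg, bracketWith_self, neg_zero]
  rw [sectionFlow, RingHom.comp_apply, taylorSeries_of_apply_eq_zero _ h]
  simp [hQ]

lemma sectionFlow_C (c : K) : sectionFlow Q x y (C c) = PowerSeries.C (Polynomial.C c) := by
  have h : bracketWith (-Q) (C c) = 0 := (bracketWith (-Q)).map_algebraMap c
  rw [sectionFlow, RingHom.comp_apply, taylorSeries_of_apply_eq_zero _ h]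
  simp

lemma sectionFlow_injective (hJ : pderiv 0 P * pderiv 1 Q - pderiv 1 P * pderiv 0 Q = 1)
    (hP : aeval ![x, y] P = Polynomial.C k)
    (hQ : aeval ![x, y] Q = Polynomial.C q + Polynomial.X) :
    Function.Injective (sectionFlow Q x y) := by
  refine (injective_iff_map_eq_zero _).2 fun f hf => ?_
  have hker : ∀ f, sectionFlow Q x y f = 0 ↔ ∀ n, aeval ![x, y] ((bracketWith (-Q))^[n] f) = 0 := by
    intro f
    rw [PowerSeries.ext_iff]
    refine forall_congr' fun n => ?_
    rw [coeff_sectionFlow, map_zero, smul_eq_zero,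
      or_iff_right (inv_ne_zero (Nat.cast_ne_zero.2 n.factorial_ne_zero))]
  refine MvPolynomial.eq_zero_of_pderiv_mem (S := {f | sectionFlow Q x y f = 0}) ?_ ?_ hf
  · intro f hf i
    rw [Set.mem_ofPred_eq] at hf ⊢
    have h1 : sectionFlow Q x y (bracketWith (-Q) f) = 0 := by
      rw [hker] at hf ⊢
      intro n
      rw [← Function.iterate_succ_apply]
      exact hf _
    have h2 : sectionFlow Q x y (bracketWith P f) = 0 := by
      rw [hker] at hf ⊢
      intro n
      rw [← bracketWith_neg_iterate_comm hJ, ← derivative_aeval_of_section hJ hP hQ, hf, map_zero]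
    rw [pderiv_eq_bracketWith hJ, map_add, map_mul, map_mul, h1, h2, mul_zero, mul_zero, add_zero]
  · intro c hc
    rw [Set.mem_ofPred_eq, sectionFlow_C] at hc
    have h0 := congrArg (PowerSeries.coeff 0) hc
    rw [PowerSeries.coeff_C, if_pos rfl, map_zero] at h0
    simpa using h0

lemma exists_aeval_eq_of_section (hJ : pderiv 0 P * pderiv 1 Q - pderiv 1 P * pderiv 0 Q = 1)
    (hP : aeval ![x, y] P = Polynomial.C k)
    (hQ : aeval ![x, y] Q = Polynomial.C q + Polynomial.X) (f : MvPolynomial (Fin 2) K) :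
    ∃ U : MvPolynomial (Fin 2) K, aeval ![P, Q] U = f := by
  obtain ⟨N, hN⟩ := exists_iterate_bracketWith_eq_zero hJ hP hQ f
  set h : ℕ → Polynomial K := fun n =>
    ((n.factorial : K)⁻¹) • aeval ![x, y] ((bracketWith (-Q))^[n] f) with hh
  have hpoly : ∀ g : Polynomial K,
      sectionFlow Q x y (Polynomial.aeval (Q - C q) g) = PowerSeries.C g := by
    intro g
    have : (sectionFlow Q x y).comp (Polynomial.aeval (R := K) (Q - C q)).toRingHom =
        (PowerSeries.C : Polynomial K →+* PowerSeries (Polynomial K)) := by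
      refine Polynomial.ringHom_ext (fun a => ?_) ?_
      · simpa [algebraMap_eq] using sectionFlow_C a
      · simp [sectionFlow_snd hQ, sectionFlow_C]
    exact RingHom.congr_fun this g
  refine ⟨∑ n ∈ Finset.range N, (X 0 - C k) ^ n * Polynomial.aeval (X 1 - C q) (h n),
    sectionFlow_injective hJ hP hQ ?_⟩
  have hU : aeval ![P, Q] (∑ n ∈ Finset.range N,
      (X 0 - C k) ^ n * Polynomial.aeval (X 1 - C q : MvPolynomial (Fin 2) K) (h n)) =
      ∑ n ∈ Finset.range N, (P - C k) ^ n * Polynomial.aeval (Q - C q) (h n) := by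
    rw [map_sum]
    refine Finset.sum_congr rfl fun n _ => ?_
    rw [map_mul, map_pow, ← Polynomial.aeval_algHom_apply]
    simp [algebraMap_eq]
  rw [hU, map_sum]
  simp only [map_mul, map_pow, map_sub, hpoly, sectionFlow_fst hJ hP, sectionFlow_C,
    add_sub_cancel_left]
  ext1 m
  rw [map_sum, coeff_sectionFlow]
  simp only [PowerSeries.coeff_X_pow_mul', PowerSeries.coeff_C]
  by_cases hm : m < N
  · rw [Finset.sum_eq_single_of_mem m (Finset.mem_range.2 hm)]
    · simp [hh]
    · intro n _ hn
      split_ifs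
      · omega
      · rfl
      · rfl
  · rw [hN m (not_lt.1 hm), smul_zero]
    refine Finset.sum_eq_zero fun n hn => ?_
    rw [Finset.mem_range] at hn
    split_ifs
    · omega
    · rfl
    · rfl

/-- A Jacobian pair one of whose fibres has a polynomial section is an automorphism. -/
theorem exists_inverse_of_section (hJ : pderiv 0 P * pderiv 1 Q - pderiv 1 P * pderiv 0 Q = 1)
    (hP : aeval ![x, y] P = Polynomial.C k)
    (hQ : aeval ![x, y] Q = Polynomial.C q + Polynomial.X) :
    ∃ U V : MvPolynomial (Fin 2) K, aeval ![P, Q] U = X 0 ∧ aeval ![P, Q] V = X 1 ∧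
      aeval ![U, V] P = X 0 ∧ aeval ![U, V] Q = X 1 := by
  obtain ⟨U, hU⟩ := exists_aeval_eq_of_section hJ hP hQ (X 0)
  obtain ⟨V, hV⟩ := exists_aeval_eq_of_section hJ hP hQ (X 1)
  have hcomp : ∀ f : MvPolynomial (Fin 2) K, aeval ![P, Q] (aeval ![U, V] f) = f := by
    intro f
    have : (aeval ![P, Q]).comp (aeval ![U, V]) = AlgHom.id K (MvPolynomial (Fin 2) K) := by
      refine MvPolynomial.algHom_ext fun i => ?_
      rw [AlgHom.comp_apply, aeval_X]
      fin_cases i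
      · exact hU
      · exact hV
    exact DFunLike.congr_fun this f
  refine ⟨U, V, hU, hV, aeval_injective_of_jacobian hJ ?_, aeval_injective_of_jacobian hJ ?_⟩
  · rw [hcomp, aeval_X]; rfl
  · rw [hcomp, aeval_X]; rfl

end Inverse

section Relation

lemma dvd_of_sum_pow_mul_eq_zero {A : Type*} [CommRing A] [IsDomain A] {p : A} (hp : p ≠ 0) {n : ℕ}
    (G : Fin n → A) (hG : ∑ a : Fin n, p ^ (a : ℕ) * G a = 0) (a₀ : Fin n)
    (h : ∀ a < a₀, G a = 0) : p ∣ G a₀ := by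
  have h1 : p ^ ((a₀ : ℕ) + 1) ∣ ∑ a ∈ Finset.univ.erase a₀, p ^ (a : ℕ) * G a := by
    refine Finset.dvd_sum fun a ha => ?_
    rcases lt_trichotomy a a₀ with h2 | h2 | h2
    · rw [h a h2, mul_zero]; exact dvd_zero _
    · exact absurd h2 (Finset.ne_of_mem_erase ha)
    · exact (pow_dvd_pow p (Nat.succ_le_of_lt h2)).mul_right _
  rw [← Finset.add_sum_erase _ _ (Finset.mem_univ a₀)] at hG
  have h2 : p ^ ((a₀ : ℕ) + 1) ∣ p ^ (a₀ : ℕ) * G a₀ := by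
    rw [eq_neg_of_add_eq_zero_left hG]; exact (dvd_neg.2 h1)
  rw [pow_succ] at h2
  exact (mul_dvd_mul_iff_left (pow_ne_zero _ hp)).1 h2

variable {K : Type*} [Field K]

lemma totalDegree_pderiv_le (f : MvPolynomial (Fin 2) K) (i : Fin 2) :
    (pderiv i f).totalDegree ≤ f.totalDegree := by
  refine Finset.sup_le fun m hm => ?_
  rw [mem_support_iff, coeff_pderiv] at hm
  have := le_totalDegree (mem_support_iff.2 (left_ne_zero_of_mul hm))
  rw [Finsupp.sum_add_index' (by simp) (by simp), Finsupp.sum_single_index rfl] at this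
  omega

lemma totalDegree_bracketWith_le (f g : MvPolynomial (Fin 2) K) :
    (bracketWith f g).totalDegree ≤ f.totalDegree + g.totalDegree := by
  rw [bracketWith_apply]
  refine (totalDegree_sub _ _).trans (max_le ?_ ?_) <;>
  exact (totalDegree_mul _ _).trans
    (add_le_add (totalDegree_pderiv_le _ _) (totalDegree_pderiv_le _ _))

lemma totalDegree_iterate_bracketWith_le (f g : MvPolynomial (Fin 2) K) (n : ℕ) :
    ((bracketWith f)^[n] g).totalDegree ≤ g.totalDegree + n * f.totalDegree := by
  induction n with
  | zero => simp
  | succ n ih =>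
    rw [Function.iterate_succ_apply', Nat.succ_mul]
    have := totalDegree_bracketWith_le f ((bracketWith f)^[n] g)
    omega

/-- A family of more than `(T + 1) ^ 2` polynomials in two variables of degree at most `T` is
linearly dependent. -/
lemma exists_sum_smul_eq_zero_of_totalDegree_le {ι : Type*} [Fintype ι] {T : ℕ}
    (v : ι → MvPolynomial (Fin 2) K) (hv : ∀ i, (v i).totalDegree ≤ T)
    (hT : (T + 1) * (T + 1) < Fintype.card ι) :
    ∃ w : ι → K, ∑ i, w i • v i = 0 ∧ ∃ i, w i ≠ 0 := by
  let c : ι → (Fin (T + 1) × Fin (T + 1) → K) := fun i d =>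
    coeff (Finsupp.single 0 (d.1 : ℕ) + Finsupp.single 1 (d.2 : ℕ)) (v i)
  have hc : ¬ LinearIndependent K c := by
    intro h
    have := h.fintype_card_le_finrank
    rw [Module.finrank_fintype_fun_eq_card, Fintype.card_prod, Fintype.card_fin] at this
    omega
  obtain ⟨w, hw, hne⟩ := Fintype.not_linearIndependent_iff.1 hc
  refine ⟨w, ?_, hne⟩
  ext m
  rw [coeff_zero, coeff_sum]
  by_cases hm : m 0 < T + 1 ∧ m 1 < T + 1
  · have := congrFun hw (⟨m 0, hm.1⟩, ⟨m 1, hm.2⟩)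
    have hm' : m = Finsupp.single 0 (m 0) + Finsupp.single 1 (m 1) := by
      ext i; fin_cases i <;> simp
    simp only [Finset.sum_apply, Pi.smul_apply, c, Pi.zero_apply, ← hm'] at this
    simpa using this
  · refine Finset.sum_eq_zero fun i _ => ?_
    rw [coeff_smul]
    by_cases h0 : coeff m (v i) = 0
    · rw [h0, smul_zero]
    · exfalso
      have h1 := (le_totalDegree (mem_support_iff.2 h0)).trans (hv i)
      rw [Finsupp.sum_fintype _ _ (by simp), Fin.sum_univ_two] at h1
      omega

/-- Modulo `P - k`, the iterated derivatives of `f` satisfy a nontrivial linear relation over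
`K[Q]`, of order and degree bounded independently of `k`. -/
lemma exists_relation_iterate_bracketWith (P Q f : MvPolynomial (Fin 2) K)
    (hP : ∀ k, P - C k ≠ 0) : ∃ N M : ℕ, ∀ k : K, ∃ R : Fin (N + 1) → Polynomial K,
      (∃ i, R i ≠ 0) ∧ (∀ i, (R i).natDegree ≤ M) ∧
      P - C k ∣ ∑ i, Polynomial.aeval Q (R i) * (bracketWith P)^[i] f := by
  classical
  set e := P.totalDegree + Q.totalDegree with he
  set N := (2 * e + 1) * (2 * e + 1) with hN
  set M := N * e + f.totalDegree with hM
  refine ⟨N, M, fun k => ?_⟩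
  set T := 2 * M * e + N * e + f.totalDegree with hT
  obtain ⟨w, hw, i₀, hi₀⟩ := exists_sum_smul_eq_zero_of_totalDegree_le (T := T)
    (fun t : Fin (M + 1) × Fin (M + 1) × Fin (N + 1) =>
      (P - C k) ^ (t.1 : ℕ) * (Q ^ (t.2.1 : ℕ) * (bracketWith P)^[t.2.2] f)) (by
        rintro ⟨a, b, i⟩
        dsimp only
        have hPk : (P - C k).totalDegree ≤ P.totalDegree := totalDegree_sub_C_le _ _
        have h1 := (totalDegree_pow (P - C k) (a : ℕ)).trans (Nat.mul_le_mul_left _ hPk)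
        have h2 := totalDegree_pow Q (b : ℕ)
        have h3 := totalDegree_iterate_bracketWith_le P f i
        refine (totalDegree_mul _ _).trans ((add_le_add le_rfl (totalDegree_mul _ _)).trans ?_)
        have ha : (a : ℕ) * P.totalDegree ≤ M * e := Nat.mul_le_mul (by omega) (by omega)
        have hb : (b : ℕ) * Q.totalDegree ≤ M * e := Nat.mul_le_mul (by omega) (by omega)
        have hi : (i : ℕ) * P.totalDegree ≤ N * e := Nat.mul_le_mul (by omega) (by omega)
        have : 2 * M * e = M * e + M * e := by ring
        omega) (by
        simp only [Fintype.card_prod, Fintype.card_fin]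
        have h1 : T + 1 ≤ (2 * e + 1) * (M + 1) := by nlinarith
        calc (T + 1) * (T + 1) ≤ ((2 * e + 1) * (M + 1)) * ((2 * e + 1) * (M + 1)) :=
              Nat.mul_le_mul h1 h1
          _ = (M + 1) * ((M + 1) * N) := by rw [hN]; ring
          _ < (M + 1) * ((M + 1) * (N + 1)) := by gcongr; omega)
  let R : Fin (M + 1) → Fin (N + 1) → Polynomial K := fun a i =>
    ∑ b : Fin (M + 1), Polynomial.monomial (b : ℕ) (w (a, b, i))
  have hcoeff : ∀ a i (b : Fin (M + 1)), (R a i).coeff b = w (a, b, i) := by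
    intro a i b
    simp only [R, Polynomial.finsetSum_coeff, Polynomial.coeff_monomial]
    rw [Finset.sum_eq_single b (fun b' _ hb => if_neg (by simpa [Fin.ext_iff] using hb))
      (by simp), if_pos rfl]
  obtain ⟨a₀, ha₀, hmin⟩ := Finset.exists_min_image
    (Finset.univ.filter fun a => ∃ i, R a i ≠ 0) id ⟨i₀.1, by
      simp only [Finset.mem_filter, Finset.mem_univ, true_and]
      refine ⟨i₀.2.2, fun h => hi₀ ?_⟩
      rw [show i₀ = (i₀.1, i₀.2.1, i₀.2.2) from rfl, ← hcoeff, h, Polynomial.coeff_zero]⟩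
  simp only [Finset.mem_filter, Finset.mem_univ, true_and] at ha₀ hmin
  refine ⟨R a₀, ha₀, fun i => ?_, ?_⟩
  · refine Polynomial.natDegree_sum_le_of_forall_le _ _ fun b _ => ?_
    exact (Polynomial.natDegree_monomial_le _).trans (by omega)
  · refine dvd_of_sum_pow_mul_eq_zero (hP k)
      (fun a => ∑ i, Polynomial.aeval Q (R a i) * (bracketWith P)^[i] f) ?_ a₀ ?_
    · rw [← hw, Fintype.sum_prod_type]
      refine Finset.sum_congr rfl fun a _ => ?_
      rw [Fintype.sum_prod_type, Finset.sum_comm, Finset.mul_sum]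
      refine Finset.sum_congr rfl fun i _ => ?_
      simp only [R, map_sum, Polynomial.aeval_monomial, Finset.sum_mul, Finset.mul_sum]
      refine Finset.sum_congr rfl fun b _ => ?_
      rw [smul_eq_C_mul, algebraMap_eq]
      ring
    · intro a ha
      refine Finset.sum_eq_zero fun i _ => ?_
      have : R a i = 0 := by
        by_contra h
        exact absurd (hmin a ⟨i, h⟩) (not_le.2 ha)
      rw [this, map_zero, zero_mul]

end Relation

section Growth

lemma eventually_lt_one_of_le_half {a : ℕ → ℝ} (ha : ∀ n, 0 ≤ a n) {w N : ℕ}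
    (h : ∀ n ≥ N, ∀ B, 0 ≤ B → (∀ j < n, n ≤ j + w → a j ≤ B) → a n ≤ B / 2) :
    ∃ n₀, ∀ n ≥ n₀, a n < 1 := by
  set B := ∑ j ∈ Finset.range N, a j with hB
  have hB0 : 0 ≤ B := Finset.sum_nonneg fun j _ => ha j
  have key : ∀ t n : ℕ, t = 0 ∨ N + t * w ≤ n + w → a n ≤ B / 2 ^ t := by
    intro t
    induction t with
    | zero =>
      intro n _
      rw [pow_zero, div_one]
      induction n using Nat.strong_induction_on with
      | _ n ih =>
        rcases lt_or_ge n N with hn | hn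
        · exact Finset.single_le_sum (fun j _ => ha j) (Finset.mem_range.2 hn)
        · have := h n hn B hB0 fun j hj _ => ih j hj (Or.inl rfl)
          linarith
    | succ t ih =>
      intro n hn
      have hn' : N + t * w ≤ n := by
        rcases hn with hn | hn
        · omega
        · rw [Nat.succ_mul] at hn; omega
      have := h n (by omega) (B / 2 ^ t) (by positivity) fun j hj hw => ih j (Or.inr (by omega))
      rw [pow_succ, ← div_div]
      exact this
  obtain ⟨t, ht⟩ := pow_unbounded_of_one_lt B (one_lt_two (α := ℝ))
  refine ⟨N + t * w, fun n hn => (key t n (Or.inr (by omega))).trans_lt ?_⟩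
  rwa [div_lt_one (by positivity)]

/-- A sequence of complex numbers that are zero or of absolute value at least one, satisfying a
linear recurrence with polynomial coefficients whose leading part is dominated by its first
term, is eventually zero. -/
lemma eventually_eq_zero_of_recurrence {c : ℕ → ℂ} {m M : ℕ} {r : ℕ → ℕ → ℂ}
    (hc : ∀ n, c n ≠ 0 → 1 ≤ ‖c n‖) (h0 : r m 0 ≠ 0)
    (hr : ∑ l ∈ Finset.range M, ‖r m (l + 1)‖ ≤ ‖r m 0‖ / 4)
    (hrec : ∀ n ≥ M, ∑ i ∈ Finset.range (m + 1), ∑ l ∈ Finset.range (M + 1),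
      r i l * (((n - l + 1).ascFactorial i : ℂ) * c (n - l + i)) = 0) :
    ∃ n₀, ∀ n ≥ n₀, c n = 0 := by
  suffices h : ∃ n₀, ∀ n ≥ n₀, ‖c n‖ < 1 by
    obtain ⟨n₀, h⟩ := h
    exact ⟨n₀, fun n hn => by_contra fun hne => absurd (hc n hne) (not_le.2 (h n hn))⟩
  set S := ∑ i ∈ Finset.range m, ∑ l ∈ Finset.range (M + 1), ‖r i l‖ with hS
  have hr0 : 0 < ‖r m 0‖ := norm_pos_iff.2 h0
  obtain ⟨N, hN⟩ := exists_nat_gt (4 * S / ‖r m 0‖)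
  refine eventually_lt_one_of_le_half (w := M + m) (N := N + M + m) (fun n => norm_nonneg _) ?_
  intro n' hn' B hB hB'
  obtain ⟨n, rfl⟩ : ∃ n, n' = n + m := ⟨n' - m, by omega⟩
  have hnN : N + M ≤ n := by omega
  have hrec := hrec n (by omega)
  have hw : ∀ i ≤ m, ∀ l ≤ M, (i < m ∨ 0 < l) → ‖c (n - l + i)‖ ≤ B := fun i hi l hl h =>
    hB' _ (by omega) (by omega)
  rw [Finset.sum_range_succ, Finset.sum_range_succ' _ M] at hrec
  simp only [Nat.sub_zero] at hrec
  set A : ℝ := ((n + 1).ascFactorial m : ℝ) with hA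
  have hA0 : 0 < A := by rw [hA]; exact_mod_cast Nat.ascFactorial_pos _ _
  have h1 : ‖∑ i ∈ Finset.range m, ∑ l ∈ Finset.range (M + 1),
      r i l * (((n - l + 1).ascFactorial i : ℂ) * c (n - l + i))‖ ≤ S * (A / (n + 1) * B) := by
    refine (norm_sum_le _ _).trans ?_
    rw [hS, Finset.sum_mul]
    refine Finset.sum_le_sum fun i hi => (norm_sum_le _ _).trans ?_
    rw [Finset.sum_mul]
    refine Finset.sum_le_sum fun l hl => ?_
    rw [Finset.mem_range] at hi hl
    rw [norm_mul, norm_mul, Complex.norm_natCast]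
    refine mul_le_mul_of_nonneg_left (mul_le_mul ?_ (hw i hi.le l (by omega) (Or.inl hi))
      (norm_nonneg _) (by positivity)) (norm_nonneg _)
    rw [le_div_iff₀ (by positivity), hA]
    have e1 : (n - l + 1).ascFactorial i ≤ (n + 1).ascFactorial i :=
      Nat.ascFactorial_le _ (by omega)
    have e2 : (n + 1).ascFactorial i * (n + 1) ≤ (n + 1).ascFactorial (i + 1) := by
      rw [Nat.ascFactorial_succ, mul_comm]
      exact Nat.mul_le_mul_right _ (by omega)
    have e3 : (n + 1).ascFactorial (i + 1) ≤ (n + 1).ascFactorial m := by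
      obtain ⟨k, rfl⟩ := Nat.exists_eq_add_of_le (Nat.succ_le_of_lt hi)
      rw [← Nat.ascFactorial_mul_ascFactorial (n + 1) i.succ k, add_right_comm]
      exact Nat.le_mul_of_pos_right _ (Nat.ascFactorial_pos _ _)
    exact_mod_cast (Nat.mul_le_mul_right _ e1).trans (e2.trans e3)
  have h2 : ‖∑ l ∈ Finset.range M,
      r m (l + 1) * (((n - (l + 1) + 1).ascFactorial m : ℂ) * c (n - (l + 1) + m))‖ ≤
      ‖r m 0‖ / 4 * (A * B) := by
    refine (norm_sum_le _ _).trans ((Finset.sum_le_sum fun l hl => ?_).trans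
      ((Finset.sum_mul _ _ _).symm.le.trans (mul_le_mul_of_nonneg_right hr (by positivity))))
    rw [Finset.mem_range] at hl
    rw [norm_mul, norm_mul, Complex.norm_natCast]
    refine mul_le_mul_of_nonneg_left (mul_le_mul ?_ (hw m le_rfl (l + 1) (by omega)
      (Or.inr (by omega))) (norm_nonneg _) hA0.le) (norm_nonneg _)
    rw [hA]
    exact_mod_cast Nat.ascFactorial_le _ (by omega)
  have h3 : ‖r m 0‖ * (A * ‖c (n + m)‖) ≤ S * (A / (n + 1) * B) + ‖r m 0‖ / 4 * (A * B) := by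
    have e : r m 0 * (((n + 1).ascFactorial m : ℂ) * c (n + m)) =
        -(∑ i ∈ Finset.range m, ∑ l ∈ Finset.range (M + 1),
          r i l * (((n - l + 1).ascFactorial i : ℂ) * c (n - l + i)) +
        ∑ l ∈ Finset.range M,
          r m (l + 1) * (((n - (l + 1) + 1).ascFactorial m : ℂ) * c (n - (l + 1) + m))) := by
      linear_combination hrec
    have e' := congrArg norm e
    rw [norm_mul, norm_mul, Complex.norm_natCast, norm_neg] at e'
    rw [e']
    exact (norm_add_le _ _).trans (add_le_add h1 h2)
  have h4 : S * (A / (n + 1) * B) ≤ ‖r m 0‖ / 4 * (A * B) := by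
    have hn1 : 4 * S / ‖r m 0‖ < (n : ℝ) + 1 := by
      have : (N : ℝ) ≤ n := by exact_mod_cast (by omega : N ≤ n)
      linarith
    rw [div_lt_iff₀ hr0] at hn1
    have hn0 : (0 : ℝ) < n + 1 := by positivity
    have e : S * (A / (n + 1) * B) = S / (n + 1) * (A * B) := by ring
    rw [e]
    refine mul_le_mul_of_nonneg_right ?_ (by positivity)
    rw [div_le_iff₀ hn0]
    linarith
  have h5 : (‖r m 0‖ * A) * ‖c (n + m)‖ ≤ (‖r m 0‖ * A) * (B / 2) := by linarith
  exact le_of_mul_le_mul_left h5 (by positivity)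

lemma sum_norm_coeff_taylor_prod_le {ρ : ℝ} (hρ : 0 < ρ) (q : ℂ) (s : Multiset ℂ)
    (hs : ∀ z ∈ s, ρ ≤ ‖q - z‖) (n : ℕ) :
    ∑ l ∈ Finset.range n, ‖(Polynomial.taylor q
        (s.map fun z => Polynomial.X - Polynomial.C z).prod).coeff l‖ ≤
      (1 + 1 / ρ) ^ (Multiset.card s) * ‖(Polynomial.taylor q
        (s.map fun z => Polynomial.X - Polynomial.C z).prod).coeff 0‖ := by
  induction s using Multiset.induction_on generalizing n with
  | empty =>
    simp only [Multiset.map_zero, Multiset.prod_zero, Polynomial.taylor_one, Multiset.card_zero,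
      pow_zero, one_mul]
    cases n with
    | zero => simp
    | succ n => rw [Finset.sum_range_succ']; simp [Polynomial.coeff_one]
  | cons z s ih =>
    have ih := ih fun z hz => hs z (Multiset.mem_cons_of_mem hz)
    have hz := hs z (Multiset.mem_cons_self z s)
    set f := Polynomial.taylor q (s.map fun z => Polynomial.X - Polynomial.C z).prod with hf
    have e : Polynomial.taylor q ((z ::ₘ s).map fun z => Polynomial.X - Polynomial.C z).prod =
        Polynomial.X * f + Polynomial.C (q - z) * f := by
      rw [Multiset.map_cons, Multiset.prod_cons, Polynomial.taylor_mul, ← hf, map_sub,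
        Polynomial.taylor_X, Polynomial.taylor_C, map_sub]
      ring
    rw [e, Multiset.card_cons]
    simp only [Polynomial.coeff_add, Polynomial.coeff_C_mul, Polynomial.coeff_X_mul_zero, zero_add,
      norm_mul]
    set W := (1 + 1 / ρ) ^ (Multiset.card s) * ‖f.coeff 0‖ with hW
    have hW0 : 0 ≤ W := by positivity
    have h1 : ∑ l ∈ Finset.range n, ‖(Polynomial.X * f).coeff l‖ ≤ W := by
      cases n with
      | zero => simpa using hW0
      | succ n =>
        rw [Finset.sum_range_succ']
        simpa [Polynomial.coeff_X_mul] using ih n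
    have h2 : ∑ l ∈ Finset.range n, ‖(Polynomial.X * f).coeff l + (q - z) * f.coeff l‖ ≤
        W + ‖q - z‖ * W := by
      refine (Finset.sum_le_sum fun l _ => norm_add_le _ _).trans ?_
      rw [Finset.sum_add_distrib]
      refine add_le_add h1 ?_
      simp only [norm_mul, ← Finset.mul_sum]
      exact mul_le_mul_of_nonneg_left (ih n) (norm_nonneg _)
    refine h2.trans ?_
    have h3 : 1 ≤ 1 / ρ * ‖q - z‖ := by
      rw [one_div_mul_eq_div, le_div_iff₀ hρ]; linarith
    have h4 : (1 + 1 / ρ) ^ (Multiset.card s + 1) * (‖q - z‖ * ‖f.coeff 0‖) =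
        (1 / ρ * ‖q - z‖) * W + ‖q - z‖ * W := by rw [hW]; ring
    rw [h4]
    nlinarith

/-- Away from its roots, a complex polynomial is dominated by the constant term of its Taylor
expansion. -/
lemma exists_sum_norm_coeff_taylor_le (M : ℕ) : ∃ ρ : ℝ, 0 < ρ ∧ ∀ (R : Polynomial ℂ) (q : ℂ),
    R ≠ 0 → R.natDegree ≤ M → (∀ z ∈ R.roots, ρ ≤ ‖q - z‖) →
      (Polynomial.taylor q R).coeff 0 ≠ 0 ∧
      ∀ n, ∑ l ∈ Finset.range n, ‖(Polynomial.taylor q R).coeff (l + 1)‖ ≤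
        ‖(Polynomial.taylor q R).coeff 0‖ / 4 := by
  have hinv : Filter.Tendsto (fun ρ : ℝ => 1 / ρ) Filter.atTop (nhds 0) := by
    simpa only [one_div] using tendsto_inv_atTop_zero (𝕜 := ℝ)
  have ht : Filter.Tendsto (fun ρ : ℝ => (1 + 1 / ρ) ^ M) Filter.atTop (nhds ((1 + 0) ^ M)) :=
    (tendsto_const_nhds.add hinv).pow M
  rw [add_zero, one_pow] at ht
  obtain ⟨ρ, hρ1, hρ0⟩ := ((ht.eventually (ge_mem_nhds (show (1 : ℝ) < 5 / 4 by norm_num))).and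
    (Filter.eventually_gt_atTop 0)).exists
  refine ⟨ρ, hρ0, fun R q hR hd hroots => ⟨fun h => ?_, fun n => ?_⟩⟩
  · rw [Polynomial.taylor_coeff_zero] at h
    have := hroots q ((Polynomial.mem_roots hR).2 h)
    rw [sub_self, norm_zero] at this
    linarith
  · have hprod := (IsAlgClosed.splits R).eq_prod_roots
    have hle := sum_norm_coeff_taylor_prod_le hρ0 q R.roots hroots (n + 1)
    set f := Polynomial.taylor q (R.roots.map fun z => Polynomial.X - Polynomial.C z).prod with hf
    have hcoeff : ∀ l, (Polynomial.taylor q R).coeff l = R.leadingCoeff * f.coeff l := by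
      intro l
      conv_lhs => rw [hprod]
      rw [Polynomial.taylor_mul, Polynomial.taylor_C, Polynomial.coeff_C_mul]
    have hpow : (1 + 1 / ρ) ^ (Multiset.card R.roots) ≤ 5 / 4 := by
      refine le_trans (pow_le_pow_right₀ ?_ ((Polynomial.card_roots' R).trans hd)) hρ1
      have : 0 < 1 / ρ := by positivity
      linarith
    rw [Finset.sum_range_succ'] at hle
    have h1 : ∑ l ∈ Finset.range n, ‖f.coeff (l + 1)‖ ≤ ‖f.coeff 0‖ / 4 := by
      have := mul_le_mul_of_nonneg_right hpow (norm_nonneg (f.coeff 0))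
      linarith
    simp only [hcoeff, norm_mul, ← Finset.mul_sum]
    rw [mul_div_assoc]
    exact mul_le_mul_of_nonneg_left h1 (norm_nonneg _)

end Growth

section PointFlow

variable {K : Type*} [Field K]

lemma exists_relation_iterate_bracketWith_ne_zero (P Q f : MvPolynomial (Fin 2) K)
    (hP : ∀ k, P - C k ≠ 0) : ∃ M : ℕ, ∀ k : K, ∃ (m : ℕ) (R : ℕ → Polynomial K),
      R m ≠ 0 ∧ (∀ i, (R i).natDegree ≤ M) ∧
      P - C k ∣ ∑ i ∈ Finset.range (m + 1), Polynomial.aeval Q (R i) * (bracketWith P)^[i] f := by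
  classical
  obtain ⟨N, M, h⟩ := exists_relation_iterate_bracketWith P Q f hP
  refine ⟨M, fun k => ?_⟩
  obtain ⟨R, ⟨i₀, hi₀⟩, hM, hdvd⟩ := h k
  obtain ⟨m, hm, hmax⟩ := Finset.exists_max_image (Finset.univ.filter fun i => R i ≠ 0) id
    ⟨i₀, by simpa using hi₀⟩
  simp only [Finset.mem_filter, Finset.mem_univ, true_and] at hm hmax
  set R' : ℕ → Polynomial K := fun i => if hi : i < N + 1 then R ⟨i, hi⟩ else 0 with hR'
  have hRR : ∀ i : Fin (N + 1), R' i = R i := fun i => by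
    rw [hR']; exact dif_pos i.2
  refine ⟨m, R', by rwa [hRR], fun i => ?_, ?_⟩
  · rw [hR']
    dsimp only
    split_ifs
    · exact hM _
    · simp
  · rw [Finset.sum_subset (Finset.range_mono (show (m : ℕ) + 1 ≤ N + 1 by omega)) ?_,
      Finset.sum_range]
    · simpa only [hRR] using hdvd
    · intro i hi him
      rw [Finset.mem_range] at hi him
      have : R ⟨i, hi⟩ = 0 := by
        by_contra hne
        have := hmax _ hne
        simp only [id, Fin.le_def] at this
        omega
      rw [hRR ⟨i, hi⟩, this, map_zero, zero_mul]

variable [CharZero K] {P Q : MvPolynomial (Fin 2) K}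

/-- The expansion at the point `a` along the fibre of `P` through `a`. -/
noncomputable def pointFlow (P : MvPolynomial (Fin 2) K) (a : Fin 2 → K) :
    MvPolynomial (Fin 2) K →+* PowerSeries K :=
  (PowerSeries.map (eval a)).comp (taylorSeries (bracketWith P))

lemma coeff_pointFlow (a : Fin 2 → K) (f : MvPolynomial (Fin 2) K) (n : ℕ) :
    PowerSeries.coeff n (pointFlow P a f) =
      (n.factorial : K)⁻¹ * eval a ((bracketWith P)^[n] f) := by
  rw [pointFlow, RingHom.comp_apply, PowerSeries.coeff_map, coeff_taylorSeries, smul_eval]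

lemma coeff_pointFlow_iterate (a : Fin 2 → K) (f : MvPolynomial (Fin 2) K) (i n : ℕ) :
    PowerSeries.coeff n (pointFlow P a ((bracketWith P)^[i] f)) =
      (n + 1).ascFactorial i * PowerSeries.coeff (n + i) (pointFlow P a f) := by
  rw [coeff_pointFlow, coeff_pointFlow, ← Function.iterate_add_apply,
    ← Nat.factorial_mul_ascFactorial]
  have h1 : (n.factorial : K) ≠ 0 := Nat.cast_ne_zero.2 n.factorial_ne_zero
  have h2 : ((n + 1).ascFactorial i : K) ≠ 0 := Nat.cast_ne_zero.2 (Nat.ascFactorial_pos _ _).ne'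
  push_cast
  field_simp

lemma pointFlow_C (a : Fin 2 → K) (c : K) : pointFlow P a (C c) = PowerSeries.C c := by
  have h : bracketWith P (C c) = 0 := (bracketWith P).map_algebraMap c
  rw [pointFlow, RingHom.comp_apply, taylorSeries_of_apply_eq_zero _ h]
  simp

lemma pointFlow_fst (a : Fin 2 → K) : pointFlow P a P = PowerSeries.C (eval a P) := by
  rw [pointFlow, RingHom.comp_apply, taylorSeries_of_apply_eq_zero _ (bracketWith_self P)]
  simp

lemma pointFlow_snd (hJ : pderiv 0 P * pderiv 1 Q - pderiv 1 P * pderiv 0 Q = 1)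
    (a : Fin 2 → K) : pointFlow P a Q = PowerSeries.C (eval a Q) + PowerSeries.X := by
  rw [pointFlow, RingHom.comp_apply,
    taylorSeries_of_apply_eq_one _ (by rw [bracketWith_apply, hJ])]
  simp

lemma pointFlow_aeval_snd (hJ : pderiv 0 P * pderiv 1 Q - pderiv 1 P * pderiv 0 Q = 1)
    (a : Fin 2 → K) (R : Polynomial K) : pointFlow P a (Polynomial.aeval Q R) =
      (Polynomial.taylor (eval a Q) R : Polynomial K) := by
  have : (pointFlow P a).comp (Polynomial.aeval (R := K) Q).toRingHom =
      (Polynomial.coeToPowerSeries.ringHom).comp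
        (Polynomial.taylorAlgHom (eval a Q)).toRingHom := by
    refine Polynomial.ringHom_ext (fun c => ?_) ?_
    · simpa [algebraMap_eq] using pointFlow_C a c
    · simp [pointFlow_snd hJ, add_comm]
  exact RingHom.congr_fun this R

lemma coeff_pointFlow_recurrence (hJ : pderiv 0 P * pderiv 1 Q - pderiv 1 P * pderiv 0 Q = 1)
    (a : Fin 2 → K) {f : MvPolynomial (Fin 2) K} {m M : ℕ} {R : ℕ → Polynomial K}
    (hM : ∀ i, (R i).natDegree ≤ M)
    (hdvd : P - C (eval a P) ∣
      ∑ i ∈ Finset.range (m + 1), Polynomial.aeval Q (R i) * (bracketWith P)^[i] f)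
    {n : ℕ} (hn : M ≤ n) :
    ∑ i ∈ Finset.range (m + 1), ∑ l ∈ Finset.range (M + 1),
      (Polynomial.taylor (eval a Q) (R i)).coeff l * (((n - l + 1).ascFactorial i : K) *
        PowerSeries.coeff (n - l + i) (pointFlow P a f)) = 0 := by
  have h0 := map_dvd (pointFlow P a) hdvd
  rw [map_sub, pointFlow_fst, pointFlow_C, sub_self, zero_dvd_iff] at h0
  have h1 := congrArg (PowerSeries.coeff n) h0
  rw [map_sum, map_sum, map_zero] at h1
  rw [← h1]
  refine Finset.sum_congr rfl fun i _ => ?_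
  rw [map_mul, pointFlow_aeval_snd hJ, PowerSeries.coeff_mul,
    Finset.Nat.sum_antidiagonal_eq_sum_range_succ_mk]
  refine (Finset.sum_subset (Finset.range_mono (by omega)) fun l _ hl => ?_).trans
    (Finset.sum_congr rfl fun l _ => ?_)
  · rw [Finset.mem_range] at hl
    rw [Polynomial.coeff_eq_zero_of_natDegree_lt, zero_mul]
    rw [Polynomial.natDegree_taylor]
    have := hM i
    omega
  · rw [coeff_pointFlow_iterate, Polynomial.coeff_coe]

/-- If the coordinates have integral expansions at `a` and `Q(a)` is far from the singularities of
their recurrence, the expansions are polynomials. -/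
lemma eventually_coeff_pointFlow_eq_zero
    (hJ : pderiv 0 P * pderiv 1 Q - pderiv 1 P * pderiv 0 Q = 1) (σ : K →+* ℂ)
    (a : Fin 2 → K) {f : MvPolynomial (Fin 2) K} {m M : ℕ} {R : ℕ → Polynomial K}
    (hM : ∀ i, (R i).natDegree ≤ M)
    (hdvd : P - C (eval a P) ∣
      ∑ i ∈ Finset.range (m + 1), Polynomial.aeval Q (R i) * (bracketWith P)^[i] f)
    (hint : ∀ n, PowerSeries.coeff n (pointFlow P a f) ≠ 0 →
      1 ≤ ‖σ (PowerSeries.coeff n (pointFlow P a f))‖)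
    (h0 : (Polynomial.taylor (σ (eval a Q)) ((R m).map σ)).coeff 0 ≠ 0)
    (hr : ∑ l ∈ Finset.range M, ‖(Polynomial.taylor (σ (eval a Q)) ((R m).map σ)).coeff (l + 1)‖ ≤
        ‖(Polynomial.taylor (σ (eval a Q)) ((R m).map σ)).coeff 0‖ / 4) :
    ∃ n₀, ∀ n ≥ n₀, PowerSeries.coeff n (pointFlow P a f) = 0 := by
  have hmap : ∀ i l, (Polynomial.taylor (σ (eval a Q)) ((R i).map σ)).coeff l =
      σ ((Polynomial.taylor (eval a Q) (R i)).coeff l) := fun i l => by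
    rw [← Polynomial.map_taylor, Polynomial.coeff_map]
  obtain ⟨n₀, h⟩ := eventually_eq_zero_of_recurrence
    (c := fun n => σ (PowerSeries.coeff n (pointFlow P a f))) (m := m) (M := M)
    (r := fun i l => (Polynomial.taylor (σ (eval a Q)) ((R i).map σ)).coeff l)
    (fun n hn => hint n fun h => hn (by rw [h, map_zero])) h0 hr
    (fun n hn => by
      have := congrArg σ (coeff_pointFlow_recurrence hJ a hM hdvd hn)
      simpa only [map_sum, map_mul, map_natCast, map_zero, hmap] using this)
  exact ⟨n₀, fun n hn => (map_eq_zero σ).1 (h n hn)⟩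

lemma exists_inverse_of_eventually_coeff_pointFlow_eq_zero
    (hJ : pderiv 0 P * pderiv 1 Q - pderiv 1 P * pderiv 0 Q = 1) (a : Fin 2 → K)
    (h : ∀ i, ∃ n₀, ∀ n ≥ n₀, PowerSeries.coeff n (pointFlow P a (X i)) = 0) :
    ∃ U V : MvPolynomial (Fin 2) K, aeval ![P, Q] U = X 0 ∧ aeval ![P, Q] V = X 1 ∧
      aeval ![U, V] P = X 0 ∧ aeval ![U, V] Q = X 1 := by
  choose n₀ hn₀ using h
  let x : Fin 2 → Polynomial K := fun i => PowerSeries.trunc (n₀ i) (pointFlow P a (X i))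
  have hx : ∀ i, (x i : PowerSeries K) = pointFlow P a (X i) := by
    intro i
    ext n
    rw [Polynomial.coeff_coe, PowerSeries.coeff_trunc]
    split_ifs with hn
    · rfl
    · exact (hn₀ i n (not_lt.1 hn)).symm
  have hx2 : x = ![x 0, x 1] := by ext1 i; fin_cases i <;> rfl
  have key : ∀ f, ((aeval ![x 0, x 1] f : Polynomial K) : PowerSeries K) = pointFlow P a f := by
    intro f
    have : (Polynomial.coeToPowerSeries.ringHom).comp (aeval (R := K) ![x 0, x 1]).toRingHom =
        pointFlow P a := by
      rw [← hx2]
      refine MvPolynomial.ringHom_ext (fun c => ?_) fun i => ?_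
      · rw [pointFlow_C]; simp [MvPolynomial.algHom_C]
      · simpa using hx i
    exact RingHom.congr_fun this f
  refine exists_inverse_of_section (x := x 0) (y := x 1) (k := eval a P) (q := eval a Q) hJ ?_ ?_
  · apply Polynomial.coe_injective K
    rw [key, pointFlow_fst, Polynomial.coe_C]
  · apply Polynomial.coe_injective K
    rw [key, pointFlow_snd hJ, Polynomial.coe_add, Polynomial.coe_C, Polynomial.coe_X]

end PointFlow

section Arithmetic

/-- The difference of two values of `f`, expanded in the differences of the coordinates,
has coefficients congruent to the partial derivatives. -/
lemma exists_eval_sub_eval_eq {R : Type*} [CommRing R] (I : Ideal R) {p p' : Fin 2 → R}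
    (hp : ∀ j, p' j - p j ∈ I) (f : MvPolynomial (Fin 2) R) :
    ∃ α : Fin 2 → R, eval p' f - eval p f = α 0 * (p' 0 - p 0) + α 1 * (p' 1 - p 1) ∧
      ∀ i, α i - eval p (pderiv i f) ∈ I := by
  induction f using MvPolynomial.induction_on with
  | C a => exact ⟨0, by simp, by simp⟩
  | add f g hf hg =>
    obtain ⟨α, h1, h2⟩ := hf
    obtain ⟨β, h3, h4⟩ := hg
    refine ⟨α + β, ?_, fun i => ?_⟩
    · simp only [map_add, Pi.add_apply]
      linear_combination h1 + h3
    · convert I.add_mem (h2 i) (h4 i) using 1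
      simp only [map_add, Pi.add_apply]
      ring
  | mul_X f j hf =>
    obtain ⟨α, h1, h2⟩ := hf
    refine ⟨fun i => α i * p' j + eval p f * Pi.single (M := fun _ => R) j 1 i, ?_, fun i => ?_⟩
    · fin_cases j
      · simp only [map_mul, eval_X, Fin.zero_eta, Pi.single_eq_same,
          Pi.single_eq_of_ne (M := fun _ => R) (show (1 : Fin 2) ≠ 0 by decide)]
        linear_combination p' 0 * h1
      · simp only [map_mul, eval_X, Fin.mk_one, Pi.single_eq_same,
          Pi.single_eq_of_ne (M := fun _ => R) (show (0 : Fin 2) ≠ 1 by decide)]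
        linear_combination p' 1 * h1
    · have h3 : eval p (pderiv i (f * X j)) =
          eval p (pderiv i f) * p j + eval p f * Pi.single (M := fun _ => R) j 1 i := by
        rw [pderiv_mul, pderiv_X, map_add, map_mul, map_mul, eval_X]
        rcases eq_or_ne i j with rfl | hij
        · simp
        · simp [Pi.single_eq_of_ne hij, Pi.single_eq_of_ne hij.symm]
      rw [h3]
      convert I.add_mem (I.mul_mem_right (p' j) (h2 i))
        (I.mul_mem_left (eval p (pderiv i f)) (hp j)) using 1
      ring

/-- A Jacobian pair is injective on each residue class of a proper ideal. -/
lemma eq_of_eval_eq_of_sub_mem {R : Type*} [CommRing R] [IsDomain R] {I : Ideal R} (hI : I ≠ ⊤)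
    {P Q : MvPolynomial (Fin 2) R}
    (hJ : pderiv 0 P * pderiv 1 Q - pderiv 1 P * pderiv 0 Q = 1) {p p' : Fin 2 → R}
    (hp : ∀ j, p' j - p j ∈ I) (hP : eval p' P = eval p P) (hQ : eval p' Q = eval p Q) :
    p' = p := by
  obtain ⟨α, h1, h2⟩ := exists_eval_sub_eval_eq I hp P
  obtain ⟨β, h3, h4⟩ := exists_eval_sub_eval_eq I hp Q
  rw [hP, sub_self] at h1
  rw [hQ, sub_self] at h3
  have hJp := congrArg (eval p) hJ
  simp only [map_sub, map_mul, map_one] at hJp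
  have hdet : α 0 * β 1 - α 1 * β 0 ≠ 0 := by
    intro h0
    refine hI ((Ideal.eq_top_iff_one I).2 ?_)
    have h5 := I.sub_mem (I.add_mem (I.mul_mem_right (β 1) (h2 0))
      (I.mul_mem_left (eval p (pderiv 0 P)) (h4 1)))
      (I.add_mem (I.mul_mem_right (β 0) (h2 1)) (I.mul_mem_left (eval p (pderiv 1 P)) (h4 0)))
    convert I.neg_mem h5 using 1
    linear_combination h0 - hJp
  have h6 : (α 0 * β 1 - α 1 * β 0) * (p' 0 - p 0) = 0 := by
    linear_combination -β 1 * h1 + α 1 * h3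
  have h7 : (α 0 * β 1 - α 1 * β 0) * (p' 1 - p 1) = 0 := by
    linear_combination β 0 * h1 - α 0 * h3
  funext j
  fin_cases j
  · exact sub_eq_zero.1 ((mul_eq_zero.1 h6).resolve_left hdet)
  · exact sub_eq_zero.1 ((mul_eq_zero.1 h7).resolve_left hdet)

variable {K : Type*} [Field K] [NumberField K]

lemma subsingleton_infinitePlace
    (hK : Module.finrank ℚ K = 1 ∨ (Module.finrank ℚ K = 2 ∧ IsEmpty (K →+* ℝ))) :
    Subsingleton (InfinitePlace K) := by
  classical
  rw [← Fintype.card_le_one_iff_subsingleton,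
    InfinitePlace.card_eq_nrRealPlaces_add_nrComplexPlaces]
  have h := InfinitePlace.card_add_two_mul_card_eq_rank K
  rcases hK with hK | ⟨hK, hr⟩
  · omega
  · have : InfinitePlace.nrRealPlaces K = 0 :=
      Fintype.card_eq_zero_iff.2 ⟨fun w => hr.false (InfinitePlace.embedding_of_isReal w.2)⟩
    omega

variable [Subsingleton (InfinitePlace K)]

lemma one_le_norm_of_ne_zero (σ : K →+* ℂ) {x : 𝓞 K} (hx : x ≠ 0) : 1 ≤ ‖σ x‖ := by
  have := InfinitePlace.one_le_of_lt_one (w := InfinitePlace.mk σ) hx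
    fun z hz => absurd (Subsingleton.elim _ _) hz
  simpa using this

lemma finite_setOf_norm_le (σ : K →+* ℂ) (B : ℝ) : {x : 𝓞 K | ‖σ x‖ ≤ B}.Finite := by
  refine Set.Finite.of_finite_image (f := ((↑) : 𝓞 K → K)) ?_
    (RingOfIntegers.coe_injective.injOn)
  refine (Embeddings.finite_of_norm_le K ℂ B).subset ?_
  rintro _ ⟨x, hx, rfl⟩
  refine ⟨x.isIntegral_coe, fun φ => ?_⟩
  have h : InfinitePlace.mk φ x = InfinitePlace.mk σ x := by
    rw [Subsingleton.elim (InfinitePlace.mk φ) (InfinitePlace.mk σ)]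
  rw [InfinitePlace.apply, InfinitePlace.apply] at h
  exact h.trans_le hx

/-- Discs of bounded radius contain boundedly many integers. -/
lemma exists_card_le_forall_norm_sub_lt (σ : K →+* ℂ) (ρ : ℝ) :
    ∃ N : ℕ, ∀ z : ℂ, ∃ s : Finset (𝓞 K), s.card ≤ N ∧ ∀ q : 𝓞 K, ‖σ q - z‖ < ρ → q ∈ s := by
  classical
  set S := (finite_setOf_norm_le σ (ρ + ρ)).toFinset with hS
  refine ⟨S.card, fun z => ?_⟩
  by_cases h : ∃ q₀ : 𝓞 K, ‖σ q₀ - z‖ < ρ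
  · obtain ⟨q₀, hq₀⟩ := h
    refine ⟨S.image (· + q₀), Finset.card_image_le, fun q hq => ?_⟩
    refine Finset.mem_image.2 ⟨q - q₀, ?_, sub_add_cancel _ _⟩
    rw [hS, Set.Finite.mem_toFinset]
    change ‖σ ((q - q₀ : 𝓞 K) : K)‖ ≤ ρ + ρ
    have : σ ((q - q₀ : 𝓞 K) : K) = (σ q - z) - (σ q₀ - z) := by
      push_cast
      rw [map_sub]
      ring
    rw [this]
    exact (norm_sub_le _ _).trans (add_le_add hq.le hq₀.le)
  · exact ⟨∅, by simp, fun q hq => absurd ⟨q, hq⟩ h⟩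

/-- The values of `Q` at those integral points of a fibre of `P` along which the expansion of `f`
does not terminate are boundedly many. -/
lemma exists_card_le_forall_eventually_coeff_eq_zero (σ : K →+* ℂ)
    {P Q : MvPolynomial (Fin 2) (𝓞 K)}
    (hJ : pderiv 0 P * pderiv 1 Q - pderiv 1 P * pderiv 0 Q = 1) (f : MvPolynomial (Fin 2) (𝓞 K)) :
    ∃ N : ℕ, ∀ k : 𝓞 K, ∃ s : Finset (𝓞 K), s.card ≤ N ∧ ∀ p : Fin 2 → 𝓞 K, eval p P = k →
      eval p Q ∉ s → ∃ n₀, ∀ n ≥ n₀, PowerSeries.coeff n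
        (pointFlow (map (algebraMap (𝓞 K) K) P) (fun j => algebraMap (𝓞 K) K (p j))
          (map (algebraMap (𝓞 K) K) f)) = 0 := by
  classical
  set ι := algebraMap (𝓞 K) K with hι
  have hJK := congrArg (map ι) hJ
  simp only [map_sub, map_mul, map_one, ← pderiv_map] at hJK
  have hP : ∀ k : K, map ι P - C k ≠ 0 := fun k h0 => by
    rw [sub_eq_zero.1 h0] at hJK
    simp at hJK
  have heval : ∀ (p : Fin 2 → 𝓞 K) (g : MvPolynomial (Fin 2) (𝓞 K)),
      eval (fun j => ι (p j)) (map ι g) = ι (eval p g) := fun p g => by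
    rw [eval_map, eval, coe_eval₂Hom, eval₂_comp_left, RingHom.comp_id]
    rfl
  obtain ⟨M, hM⟩ := exists_relation_iterate_bracketWith_ne_zero (map ι P) (map ι Q) (map ι f) hP
  obtain ⟨ρ, -, hρ⟩ := exists_sum_norm_coeff_taylor_le M
  obtain ⟨N, hN⟩ := exists_card_le_forall_norm_sub_lt σ ρ
  choose s hsN hs using hN
  refine ⟨M * N, fun k => ?_⟩
  obtain ⟨m, R, hm, hRM, hdvd⟩ := hM (ι k)
  have hm' : (R m).map σ ≠ 0 := (Polynomial.map_ne_zero_iff σ.injective).2 hm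
  have hdeg : ((R m).map σ).natDegree ≤ M := Polynomial.natDegree_map_le.trans (hRM m)
  refine ⟨((R m).map σ).roots.toFinset.biUnion s, ?_, fun p hp hq => ?_⟩
  · refine (Finset.card_biUnion_le_card_mul _ _ N fun z _ => hsN z).trans
      (Nat.mul_le_mul_right _ ?_)
    exact (Multiset.toFinset_card_le _).trans ((Polynomial.card_roots' _).trans hdeg)
  · have hfar : ∀ z ∈ ((R m).map σ).roots, ρ ≤ ‖σ (ι (eval p Q)) - z‖ := fun z hz => by
      by_contra! hlt
      exact hq (Finset.mem_biUnion.2 ⟨z, Multiset.mem_toFinset.2 hz, hs z _ hlt⟩)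
    obtain ⟨h0, hr⟩ := hρ _ _ hm' hdeg hfar
    rw [← heval] at h0 hr
    refine eventually_coeff_pointFlow_eq_zero hJK σ _ hRM (by rwa [heval, hp]) (fun n hn => ?_)
      h0 (hr M)
    obtain ⟨g, hg⟩ := coeff_taylorSeries_mem_range ι P Q hJ n f
    rw [pointFlow, RingHom.comp_apply, PowerSeries.coeff_map, ← hg] at hn ⊢
    change eval _ (map ι g) ≠ 0 at hn
    change 1 ≤ ‖σ (eval _ (map ι g))‖
    rw [heval] at hn ⊢
    exact one_le_norm_of_ne_zero σ fun h => hn (by rw [h, map_zero])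

end Arithmetic

/-- Let `K` be `ℚ` or an imaginary quadratic field. If `F = (P,Q)` is a Jacobian pair
over `𝓞 K` that is not invertible over `K`, then the numbers of integral points on the
fibers `P = k`, `k ∈ 𝓞 K`, are uniformly bounded by a constant. -/
theorem uniform_bound_integral_points_on_fibers_of_noninvertible
    (K : Type*) [Field K] [NumberField K]
    (hK : Module.finrank ℚ K = 1 ∨
      (Module.finrank ℚ K = 2 ∧ IsEmpty (K →+* ℝ)))
    (P Q : MvPolynomial (Fin 2) (𝓞 K))
    (hJac : pderiv 0 P * pderiv 1 Q - pderiv 1 P * pderiv 0 Q = 1)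
    (hnotinv : ¬ ∃ U V : MvPolynomial (Fin 2) K,
      aeval ![MvPolynomial.map (algebraMap (𝓞 K) K) P,
              MvPolynomial.map (algebraMap (𝓞 K) K) Q] U = X 0 ∧
      aeval ![MvPolynomial.map (algebraMap (𝓞 K) K) P,
              MvPolynomial.map (algebraMap (𝓞 K) K) Q] V = X 1 ∧
      aeval ![U, V] (MvPolynomial.map (algebraMap (𝓞 K) K) P) = X 0 ∧
      aeval ![U, V] (MvPolynomial.map (algebraMap (𝓞 K) K) Q) = X 1) :
    ∃ C : ℕ, ∀ k : 𝓞 K,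
      {p : 𝓞 K × 𝓞 K | eval ![p.1, p.2] P = k}.Finite ∧
      Nat.card {p : 𝓞 K × 𝓞 K | eval ![p.1, p.2] P = k} ≤ C := by
  classical
  have := subsingleton_infinitePlace hK
  obtain ⟨σ⟩ : Nonempty (K →+* ℂ) := inferInstance
  have hJK := congrArg (map (algebraMap (𝓞 K) K)) hJac
  simp only [map_sub, map_mul, map_one, ← pderiv_map] at hJK
  obtain ⟨N₀, h₀⟩ := exists_card_le_forall_eventually_coeff_eq_zero σ hJac (X 0)
  obtain ⟨N₁, h₁⟩ := exists_card_le_forall_eventually_coeff_eq_zero σ hJac (X 1)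
  obtain ⟨I, hI⟩ := Ideal.exists_maximal (𝓞 K)
  refine ⟨(N₀ + N₁) * (Nat.card (𝓞 K ⧸ I) * Nat.card (𝓞 K ⧸ I)), fun k => ?_⟩
  obtain ⟨s₀, hs₀, hz₀⟩ := h₀ k
  obtain ⟨s₁, hs₁, hz₁⟩ := h₁ k
  have hmem : ∀ p : Fin 2 → 𝓞 K, eval p P = k → eval p Q ∈ s₀ ∪ s₁ := fun p hp => by
    by_contra hq
    rw [Finset.mem_union, not_or] at hq
    refine hnotinv (exists_inverse_of_eventually_coeff_pointFlow_eq_zero hJK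
      (fun j => algebraMap (𝓞 K) K (p j)) fun i => ?_)
    fin_cases i
    · simpa only [map_X, Fin.zero_eta] using hz₀ p hp hq.1
    · simpa only [map_X, Fin.mk_one] using hz₁ p hp hq.2
  set g : {p : 𝓞 K × 𝓞 K | eval ![p.1, p.2] P = k} →
      (s₀ ∪ s₁ : Finset (𝓞 K)) × (𝓞 K ⧸ I) × (𝓞 K ⧸ I) := fun p =>
    (⟨eval ![p.1.1, p.1.2] Q, hmem _ p.2⟩, Ideal.Quotient.mk I p.1.1, Ideal.Quotient.mk I p.1.2)
  have hg : Function.Injective g := by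
    rintro ⟨⟨a, b⟩, hab⟩ ⟨⟨c, d⟩, hcd⟩ h
    simp only [g, Prod.mk.injEq, Subtype.mk.injEq, Ideal.Quotient.eq] at h
    have := eq_of_eval_eq_of_sub_mem hI.ne_top hJac (p := ![c, d]) (p' := ![a, b])
      (fun j => by fin_cases j; exacts [h.2.1, h.2.2]) (hab.trans hcd.symm) h.1
    exact Subtype.ext (Prod.ext (congrFun this 0) (congrFun this 1))
  refine ⟨Set.finite_coe_iff.1 (Finite.of_injective g hg), ?_⟩
  refine (Nat.card_le_card_of_injective g hg).trans ?_
  rw [Nat.card_prod, Nat.card_prod, Nat.card_eq_fintype_card, Fintype.card_coe]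
  exact Nat.mul_le_mul_right _ ((Finset.card_union_le _ _).trans (add_le_add hs₀ hs₁))
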